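/- For any b ∈ B_n and any bounded measurable function φ on X × X: sup_{N ≥ 1} N·E[(μ_b^N(φ) − μ_b(φ))²] < ∞, and hence μ_b^N(φ) → μ_b(φ) in probability as N → ∞. -/

import Mathlib

open MeasureTheory ProbabilityTheory Filter
open scoped ENNReal NNReal Classical

noncomputable section

namespace PFVar

variable {X : Type*} [MeasurableSpace X]

/-- The unnormalized Feynman–Kac measures `γ_p`. -/
def gammaFK (M0 : Measure X) (M : ℕ → Kernel X X) (G : ℕ → X → ℝ) : ℕ → Measure X
  | 0 => M0
  | p + 1 =>
      ((gammaFK M0 M G p).withDensity fun x => ENNReal.ofReal (G p x)).bind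
        (fun x => M (p + 1) x)

/-- `γ_n(φ)`. -/
def gInt (M0 : Measure X) (M : ℕ → Kernel X X) (G : ℕ → X → ℝ) (n : ℕ) (φ : X → ℝ) : ℝ :=
  ∫ x, φ x ∂(gammaFK M0 M G n)

/-- `η_n(φ) = γ_n(φ)/γ_n(1)`. -/
def eInt (M0 : Measure X) (M : ℕ → Kernel X X) (G : ℕ → X → ℝ) (n : ℕ) (φ : X → ℝ) : ℝ :=
  gInt M0 M G n φ / gInt M0 M G n 1

/-- Law of the path `(X_0,…,X_k)` of an inhomogeneous Markov chain with initial law `μ0` and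
transitions `κ`, recorded as an element of `ℕ → Y` (coordinates beyond `k` are junk). -/
def markovPath {Y : Type*} [MeasurableSpace Y] (μ0 : Measure Y) (κ : ℕ → Y → Measure Y) :
    ℕ → Measure (ℕ → Y)
  | 0 => μ0.map fun y _ => y
  | k + 1 =>
      (markovPath μ0 κ k).bind fun ω =>
        (κ (k + 1) (ω k)).map fun y => Function.update ω (k + 1) y

/-- Categorical distribution on `{0,…,m−1} ⊆ ℕ` with weights `w`. -/
def cat (m : ℕ) (w : ℕ → ℝ) : Measure ℕ :=
  (∑ j ∈ Finset.range m, ENNReal.ofReal (w j))⁻¹ •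
    ∑ j ∈ Finset.range m, ENNReal.ofReal (w j) • Measure.dirac j

/-- Uniform distribution on `{0,…,m−1}`. -/
def unif (m : ℕ) : Measure ℕ := cat m fun _ => 1

/-- Extend a finite tuple to `ℕ` with junk values. -/
def padF {Y : Type*} [Nonempty Y] {m : ℕ} (f : Fin m → Y) : ℕ → Y := fun i =>
  if h : i < m then f ⟨i, h⟩ else Classical.arbitrary Y

/-- One resampling/mutation step of the particle filter: given the time-`p` configuration `z`,
the joint law of the ancestor indices `A_p` and the time-`p+1` particle configuration;
each of the `Np (p+1)` new particles independently draws an ancestor from the categorical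
distribution with weights `G p (z j)`, `j < Np p`, and then moves according to `M (p+1)`. -/
def pfStep [Nonempty X] (M : ℕ → Kernel X X) (G : ℕ → X → ℝ) (Np : ℕ → ℕ) (p : ℕ)
    (z : ℕ → X) : Measure ((ℕ → ℕ) × (ℕ → X)) :=
  (Measure.pi fun _ : Fin (Np (p + 1)) =>
      (cat (Np p) fun j => G p (z j)).bind fun a =>
        (M (p + 1) (z a)).map fun x => (a, x)).map fun f =>
    (padF fun i => (f i).1, padF fun i => (f i).2)

/-- The law of the particle system `(ζ, A)` run up to time `k`: the first component is
`ζ : time → particle index → X`, the second is `A : time → particle index → ℕ`, where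
`A p i` is the ancestor index of particle `i` of generation `p+1`. -/
def pfLaw [Nonempty X] (M0 : Measure X) (M : ℕ → Kernel X X) (G : ℕ → X → ℝ)
    (Np : ℕ → ℕ) : ℕ → Measure ((ℕ → ℕ → X) × (ℕ → ℕ → ℕ))
  | 0 =>
      (Measure.pi fun _ : Fin (Np 0) => M0).map fun f =>
        (fun p => if p = 0 then padF f else fun _ => Classical.arbitrary X, fun _ _ => 0)
  | k + 1 =>
      (pfLaw M0 M G Np k).bind fun ω =>
        (pfStep M G Np k (ω.1 k)).map fun az =>
          (Function.update ω.1 (k + 1) az.2, Function.update ω.2 k az.1)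

/-- Eve indices: `eve A 0 i = i` and `eve A (p+1) i = eve A p (A p i)`. -/
def eve (A : ℕ → ℕ → ℕ) : ℕ → ℕ → ℕ
  | 0 => fun i => i
  | p + 1 => fun i => eve A p (A p i)

/-- `η_n^N(φ)`. -/
def etaN (Np : ℕ → ℕ) (n : ℕ) (φ : X → ℝ) (ω : (ℕ → ℕ → X) × (ℕ → ℕ → ℕ)) : ℝ :=
  (Np n : ℝ)⁻¹ * ∑ i ∈ Finset.range (Np n), φ (ω.1 n i)

/-- `γ_n^N(φ)`. -/
def gammaN (G : ℕ → X → ℝ) (Np : ℕ → ℕ) (n : ℕ) (φ : X → ℝ)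
    (ω : (ℕ → ℕ → X) × (ℕ → ℕ → ℕ)) : ℝ :=
  (∏ p ∈ Finset.range n, etaN Np p (G p) ω) * etaN Np n φ ω

/-- The variance estimator `V_n^N(φ)`. -/
def Vest (Np : ℕ → ℕ) (n : ℕ) (φ : X → ℝ) (ω : (ℕ → ℕ → X) × (ℕ → ℕ → ℕ)) : ℝ :=
  etaN Np n φ ω ^ 2 -
    (∏ p ∈ Finset.range n, (Np p : ℝ) / ((Np p : ℝ) - 1)) *
      ((Np n : ℝ) * ((Np n : ℝ) - 1))⁻¹ *
      ∑ i ∈ Finset.range (Np n), ∑ j ∈ Finset.range (Np n),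
        if eve ω.2 n i ≠ eve ω.2 n j then φ (ω.1 n i) * φ (ω.1 n j) else 0

/-- Initial law of the doubled chain used to define `μ_b`. -/
def pairInit (M0 : Measure X) (b : ℕ → Bool) : Measure (X × X) :=
  if b 0 then M0.map fun x => (x, x) else M0.prod M0

/-- Transitions of the doubled chain used to define `μ_b`. -/
def pairKer (M : ℕ → Kernel X X) (b : ℕ → Bool) (p : ℕ) (q : X × X) : Measure (X × X) :=
  if b p then (M p q.1).map fun y => (y, y) else (M p q.1).prod (M p q.2)

/-- `μ_b(φ) = E_b[φ(X_n, X_n') ∏_{p<n} G_p(X_p) G_p(X_p')]`. -/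
def muB (M0 : Measure X) (M : ℕ → Kernel X X) (G : ℕ → X → ℝ) (n : ℕ) (b : ℕ → Bool)
    (φ : X × X → ℝ) : ℝ :=
  ∫ ω, φ (ω n) * ∏ p ∈ Finset.range n, G p (ω p).1 * G p (ω p).2
    ∂(markovPath (pairInit M0 b) (pairKer M b) n)

/-- `φ ⊗ φ`. -/
def tens (φ : X → ℝ) : X × X → ℝ := fun q => φ q.1 * φ q.2

/-- The binary string `e_p`. -/
def eVec (p : ℕ) : ℕ → Bool := fun q => q == p

/-- The zero binary string `0_n`. -/
def zeroVec : ℕ → Bool := fun _ => false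

/-- Extension of a finite binary string to `ℕ → Bool`. -/
def extB (n : ℕ) (b : Fin (n + 1) → Bool) : ℕ → Bool := fun p =>
  if h : p < n + 1 then b ⟨p, h⟩ else false

/-- `v_{p,n}(φ) = (μ_{e_p}(φ⊗φ) − μ_{0_n}(φ⊗φ)) / γ_n(1)²`. -/
def vpn (M0 : Measure X) (M : ℕ → Kernel X X) (G : ℕ → X → ℝ) (n p : ℕ) (φ : X → ℝ) : ℝ :=
  (muB M0 M G n (eVec p) (tens φ) - muB M0 M G n zeroVec (tens φ)) / gInt M0 M G n 1 ^ 2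

/-- `σ_n²(φ) = Σ_{p=0}^n c_p⁻¹ v_{p,n}(φ)`. -/
def sigma2 (M0 : Measure X) (M : ℕ → Kernel X X) (G : ℕ → X → ℝ) (c : ℕ → ℝ) (n : ℕ)
    (φ : X → ℝ) : ℝ :=
  ∑ p ∈ Finset.range (n + 1), (c p)⁻¹ * vpn M0 M G n p φ

/-- Particle numbers `N_p = ⌈c_p N⌉`. -/
def npart (c : ℕ → ℝ) (N : ℕ) (p : ℕ) : ℕ := ⌈c p * (N : ℝ)⌉₊

/-- Backward tracing: `traceAux A n kn j = K_{n-j}` where `K_n = kn`, `K_p = A p (K_{p+1})`. -/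
def traceAux (A : ℕ → ℕ → ℕ) (n kn : ℕ) : ℕ → ℕ
  | 0 => kn
  | j + 1 => A (n - (j + 1)) (traceAux A n kn j)

/-- The deterministic ancestral trace `K¹`: `trace A n kn p = K_p¹` given `K_n¹ = kn`. -/
def trace (A : ℕ → ℕ → ℕ) (n kn : ℕ) : ℕ → ℕ := fun p => traceAux A n kn (n - p)

/-- Conditional law of the broken-lineage trace `(K_0²,…,K_p²)` given `K_p² = v`
(entries above `p` are junk, to be overwritten). -/
def k2Law (G : ℕ → X → ℝ) (Np : ℕ → ℕ) (ω : (ℕ → ℕ → X) × (ℕ → ℕ → ℕ)) (K1 : ℕ → ℕ) :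
    ℕ → ℕ → Measure (ℕ → ℕ)
  | 0 => fun v => Measure.dirac fun q => if q = 0 then v else 0
  | p + 1 => fun v =>
      ((if v = K1 (p + 1) then cat (Np p) fun j => G p (ω.1 p j)
          else Measure.dirac (ω.2 p v)).bind fun w =>
        (k2Law G Np ω K1 p w).map fun f => Function.update f (p + 1) v)

/-- Conditional law of `(K¹, K²)` given the particle system `ω = (ζ, A)`. -/
def kLaw (G : ℕ → X → ℝ) (Np : ℕ → ℕ) (n : ℕ) (ω : (ℕ → ℕ → X) × (ℕ → ℕ → ℕ)) :
    Measure ((ℕ → ℕ) × (ℕ → ℕ)) :=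
  (unif (Np n)).bind fun k1n =>
    (unif (Np n)).bind fun k2n =>
      (k2Law G Np ω (trace ω.2 n k1n) n k2n).map fun k2 => (trace ω.2 n k1n, k2)

/-- Joint law of the particle system together with the tracing variables `(K¹, K²)`. -/
def pfkLaw [Nonempty X] (M0 : Measure X) (M : ℕ → Kernel X X) (G : ℕ → X → ℝ)
    (Np : ℕ → ℕ) (n : ℕ) :
    Measure (((ℕ → ℕ → X) × (ℕ → ℕ → ℕ)) × ((ℕ → ℕ) × (ℕ → ℕ))) :=
  (pfLaw M0 M G Np n).bind fun ω => (kLaw G Np n ω).map fun k => (ω, k)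

/-- `(k¹, k²) ∈ I(b)`. -/
def inI (Np : ℕ → ℕ) (n : ℕ) (b : ℕ → Bool) (k : (ℕ → ℕ) × (ℕ → ℕ)) : Prop :=
  ∀ p ≤ n, k.1 p < Np p ∧ k.2 p < Np p ∧ (k.1 p = k.2 p ↔ b p = true)

/-- The particle approximation `μ_b^N(φ)` (a function of the realization `ω = (ζ, A)`);
the conditional expectation given `(A, ζ)` is the integral with respect to `kLaw`. -/
def muBN (G : ℕ → X → ℝ) (Np : ℕ → ℕ) (n : ℕ) (b : ℕ → Bool) (φ : X × X → ℝ)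
    (ω : (ℕ → ℕ → X) × (ℕ → ℕ → ℕ)) : ℝ :=
  (∏ p ∈ Finset.range (n + 1),
      if b p then (Np p : ℝ) else (Np p : ℝ) / ((Np p : ℝ) - 1)) *
    gammaN G Np n 1 ω ^ 2 *
    ∫ k, (if inI Np n b k then (1 : ℝ) else 0) * φ (ω.1 n (k.1 n), ω.1 n (k.2 n))
      ∂(kLaw G Np n ω)

/-- `v_{p,n}^N(φ)`. -/
def vpnN (G : ℕ → X → ℝ) (Np : ℕ → ℕ) (n p : ℕ) (φ : X → ℝ)
    (ω : (ℕ → ℕ → X) × (ℕ → ℕ → ℕ)) : ℝ :=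
  (muBN G Np n (eVec p) (tens φ) ω - muBN G Np n zeroVec (tens φ) ω) / gammaN G Np n 1 ω ^ 2

/-- `v_n^N(φ) = Σ_{p=0}^n c_p⁻¹ v_{p,n}^N(φ)`. -/
def vnN (G : ℕ → X → ℝ) (Np : ℕ → ℕ) (c : ℕ → ℝ) (n : ℕ) (φ : X → ℝ)
    (ω : (ℕ → ℕ → X) × (ℕ → ℕ → ℕ)) : ℝ :=
  ∑ p ∈ Finset.range (n + 1), (c p)⁻¹ * vpnN G Np n p φ ω

/-- `QAux M G n φ j = Q_{n-j,n}(φ)`. -/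
def QAux (M : ℕ → Kernel X X) (G : ℕ → X → ℝ) (n : ℕ) (φ : X → ℝ) : ℕ → X → ℝ
  | 0 => φ
  | j + 1 => fun x => G (n - (j + 1)) x * ∫ y, QAux M G n φ j y ∂(M (n - j) x)

/-- `Q_{p,n}(φ)` where `Q_p(x, dx') = G_{p-1}(x) M_p(x, dx')`, `Q_{n,n} = Id`,
`Q_{p,n} = Q_{p+1} ⋯ Q_n`. -/
def Qpn (M : ℕ → Kernel X X) (G : ℕ → X → ℝ) (n p : ℕ) (φ : X → ℝ) : X → ℝ :=
  QAux M G n φ (n - p)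

/-- `φ̂ = G_n · φ`. -/
def hatf (G : ℕ → X → ℝ) (n : ℕ) (φ : X → ℝ) : X → ℝ := fun x => G n x * φ x

/-- `γ̂_n(φ) = γ_n(G_n φ)`. -/
def gHatInt (M0 : Measure X) (M : ℕ → Kernel X X) (G : ℕ → X → ℝ) (n : ℕ) (φ : X → ℝ) : ℝ :=
  gInt M0 M G n (hatf G n φ)

/-- `η̂_n(φ) = γ̂_n(φ)/γ̂_n(1)`. -/
def eHatInt (M0 : Measure X) (M : ℕ → Kernel X X) (G : ℕ → X → ℝ) (n : ℕ) (φ : X → ℝ) : ℝ :=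
  gHatInt M0 M G n φ / gHatInt M0 M G n 1

/-- `γ̂_n^N(φ) = γ_n^N(G_n φ)`. -/
def gammaHatN (G : ℕ → X → ℝ) (Np : ℕ → ℕ) (n : ℕ) (φ : X → ℝ)
    (ω : (ℕ → ℕ → X) × (ℕ → ℕ → ℕ)) : ℝ :=
  gammaN G Np n (hatf G n φ) ω

/-- `η̂_n^N(φ) = γ̂_n^N(φ)/γ̂_n^N(1)`. -/
def etaHatN (G : ℕ → X → ℝ) (Np : ℕ → ℕ) (n : ℕ) (φ : X → ℝ)
    (ω : (ℕ → ℕ → X) × (ℕ → ℕ → ℕ)) : ℝ :=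
  gammaHatN G Np n φ ω / gammaHatN G Np n 1 ω

/-- `v̂_{p,n}(φ) = v_{p,n}(φ̂)/η_n(G_n)²`. -/
def vpnHat (M0 : Measure X) (M : ℕ → Kernel X X) (G : ℕ → X → ℝ) (n p : ℕ) (φ : X → ℝ) : ℝ :=
  vpn M0 M G n p (hatf G n φ) / eInt M0 M G n (G n) ^ 2

/-- `σ̂_n²(φ) = Σ_{p=0}^n c_p⁻¹ v̂_{p,n}(φ)`. -/
def sigma2Hat (M0 : Measure X) (M : ℕ → Kernel X X) (G : ℕ → X → ℝ) (c : ℕ → ℝ) (n : ℕ)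
    (φ : X → ℝ) : ℝ :=
  ∑ p ∈ Finset.range (n + 1), (c p)⁻¹ * vpnHat M0 M G n p φ

/-- `V̂_n^N(φ) = V_n^N(φ̂)/η_n^N(G_n)²`. -/
def VestHat (G : ℕ → X → ℝ) (Np : ℕ → ℕ) (n : ℕ) (φ : X → ℝ)
    (ω : (ℕ → ℕ → X) × (ℕ → ℕ → ℕ)) : ℝ :=
  Vest Np n (hatf G n φ) ω / etaN Np n (G n) ω ^ 2

/-- `v̂_{p,n}^N(φ) = v_{p,n}^N(φ̂)/η_n^N(G_n)²`. -/
def vpnHatN (G : ℕ → X → ℝ) (Np : ℕ → ℕ) (n p : ℕ) (φ : X → ℝ)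
    (ω : (ℕ → ℕ → X) × (ℕ → ℕ → ℕ)) : ℝ :=
  vpnN G Np n p (hatf G n φ) ω / etaN Np n (G n) ω ^ 2

/-- `v̂_n^N(φ) = Σ_{p=0}^n c_p⁻¹ v̂_{p,n}^N(φ)`. -/
def vnHatN (G : ℕ → X → ℝ) (Np : ℕ → ℕ) (c : ℕ → ℝ) (n : ℕ) (φ : X → ℝ)
    (ω : (ℕ → ℕ → X) × (ℕ → ℕ → ℕ)) : ℝ :=
  ∑ p ∈ Finset.range (n + 1), (c p)⁻¹ * vpnHatN G Np n p φ ω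

section Preliminaries

variable {α β γ : Type*} [MeasurableSpace α] [MeasurableSpace β] [MeasurableSpace γ]

/-- Bounded measurable real functions. -/
def BddMeas (f : α → ℝ) : Prop := Measurable f ∧ ∃ C, ∀ x, |f x| ≤ C

lemma BddMeas.integrable {f : α → ℝ} (hf : BddMeas f) (μ : Measure α) [IsFiniteMeasure μ] :
    Integrable f μ := by
  obtain ⟨hm, C, hC⟩ := hf
  exact Integrable.of_bound hm.aestronglyMeasurable C (ae_of_all _ fun x => by simpa using hC x)

lemma BddMeas.const (c : ℝ) : BddMeas fun _ : α => c := ⟨measurable_const, |c|, fun _ => le_rfl⟩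

lemma BddMeas.add {f g : α → ℝ} (hf : BddMeas f) (hg : BddMeas g) :
    BddMeas fun x => f x + g x := by
  obtain ⟨hm, C, hC⟩ := hf
  obtain ⟨hm', C', hC'⟩ := hg
  exact ⟨hm.add hm', C + C', fun x => (abs_add_le _ _).trans (add_le_add (hC x) (hC' x))⟩

lemma BddMeas.mul {f g : α → ℝ} (hf : BddMeas f) (hg : BddMeas g) :
    BddMeas fun x => f x * g x := by
  obtain ⟨hm, C, hC⟩ := hf
  obtain ⟨hm', C', hC'⟩ := hg
  refine ⟨hm.mul hm', C * C', fun x => ?_⟩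
  rw [abs_mul]
  exact mul_le_mul (hC x) (hC' x) (abs_nonneg _) ((abs_nonneg _).trans (hC x))

lemma BddMeas.const_mul {f : α → ℝ} (c : ℝ) (hf : BddMeas f) : BddMeas fun x => c * f x :=
  (BddMeas.const c).mul hf

lemma BddMeas.sub {f g : α → ℝ} (hf : BddMeas f) (hg : BddMeas g) :
    BddMeas fun x => f x - g x := by
  simpa [sub_eq_add_neg] using hf.add (hg.const_mul (-1))

lemma BddMeas.sq {f : α → ℝ} (hf : BddMeas f) : BddMeas fun x => f x ^ 2 := by
  simpa [pow_two] using hf.mul hf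

lemma BddMeas.sum {ι : Type*} (s : Finset ι) {f : ι → α → ℝ} (hf : ∀ i ∈ s, BddMeas (f i)) :
    BddMeas fun x => ∑ i ∈ s, f i x := by
  induction s using Finset.induction_on with
  | empty => simpa using BddMeas.const (α := α) 0
  | insert a s ha ih =>
    simp only [Finset.sum_insert ha]
    exact (hf a (by simp)).add (ih fun i hi => hf i (by simp [hi]))

lemma BddMeas.prod {ι : Type*} (s : Finset ι) {f : ι → α → ℝ} (hf : ∀ i ∈ s, BddMeas (f i)) :
    BddMeas fun x => ∏ i ∈ s, f i x := by
  induction s using Finset.induction_on with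
  | empty => simpa using BddMeas.const (α := α) 1
  | insert a s ha ih =>
    simp only [Finset.prod_insert ha]
    exact (hf a (by simp)).mul (ih fun i hi => hf i (by simp [hi]))

lemma BddMeas.comp {f : β → ℝ} (hf : BddMeas f) {g : α → β} (hg : Measurable g) :
    BddMeas fun x => f (g x) :=
  ⟨hf.1.comp hg, hf.2.imp fun _ h x => h (g x)⟩

lemma BddMeas.integral {κ : α → Measure β} (hκ : Measurable κ)
    [hp : ∀ a, IsProbabilityMeasure (κ a)]
    {f : α × β → ℝ} (hf : BddMeas f) : BddMeas fun a => ∫ y, f (a, y) ∂(κ a) := by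
  obtain ⟨hm, C, hC⟩ := hf
  let η : Kernel α β := ⟨κ, hκ⟩
  have : IsMarkovKernel η := ⟨hp⟩
  refine ⟨?_, C, fun a => ?_⟩
  · have h := MeasureTheory.StronglyMeasurable.integral_kernel_prod_right' (κ := η)
      hm.stronglyMeasurable
    exact h.measurable
  · have h := norm_integral_le_of_norm_le_const (μ := κ a) (f := fun y => f (a, y)) (C := C)
      (ae_of_all _ fun y => by simpa using hC (a, y))
    simpa using h

lemma integral_bind_of_bddMeas {μ : Measure α} [IsProbabilityMeasure μ] {κ : α → Measure β}
    (hκ : Measurable κ) [hp : ∀ a, IsProbabilityMeasure (κ a)] {f : β → ℝ} (hf : BddMeas f) :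
    ∫ y, f y ∂(μ.bind κ) = ∫ a, ∫ y, f y ∂(κ a) ∂μ := by
  let η : Kernel α β := ⟨κ, hκ⟩
  have : IsMarkovKernel η := ⟨hp⟩
  have h := Kernel.integral_comp (κ := Kernel.const Unit μ) (η := η) (a := ()) (f := f)
    (hf.integrable _)
  rw [Kernel.comp_apply] at h
  simpa [η] using h

lemma isProbabilityMeasure_bind_of_forall {μ : Measure α} [IsProbabilityMeasure μ]
    {κ : α → Measure β} (hκ : Measurable κ) [hp : ∀ a, IsProbabilityMeasure (κ a)] :
    IsProbabilityMeasure (μ.bind κ) :=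
  isProbabilityMeasure_bind hκ.aemeasurable (ae_of_all _ hp)

lemma measurable_map_of_joint {κ : α → Measure β} (hκ : Measurable κ)
    [hp : ∀ a, IsProbabilityMeasure (κ a)] {g : α × β → γ} (hg : Measurable g) :
    Measurable fun a => (κ a).map fun y => g (a, y) := by
  let η : Kernel α β := ⟨κ, hκ⟩
  have : IsMarkovKernel η := ⟨hp⟩
  refine Measure.measurable_of_measurable_coe _ fun s hs => ?_
  have h := Kernel.measurable_kernel_prodMk_left (κ := η) (hg hs)
  have heq : ∀ a, ((κ a).map fun y => g (a, y)) s = η a (Prod.mk a ⁻¹' (g ⁻¹' s)) := fun a => by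
    rw [Measure.map_apply (by fun_prop) hs]
    rfl
  simpa only [heq] using h

lemma measurable_measure_pi {m : ℕ} {κ : α → Measure β} (hκ : Measurable κ)
    [hp : ∀ a, IsProbabilityMeasure (κ a)] :
    Measurable fun a => Measure.pi fun _ : Fin m => κ a := by
  refine Measurable.measure_of_isPiSystem_of_isProbabilityMeasure
    (generateFrom_pi (α := fun _ : Fin m => β)).symm isPiSystem_pi ?_
  rintro _ ⟨t, ht, rfl⟩
  simp only [Measure.pi_pi]
  exact Finset.measurable_prod _ fun i _ => Measure.measurable_coe (ht i trivial) |>.comp hκ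

end Preliminaries

section IndependentSample

variable {Y : Type*} [MeasurableSpace Y] {ν : Measure Y} [IsProbabilityMeasure ν] {m : ℕ}

lemma iIndepFun_pi_eval : iIndepFun (fun (i : Fin m) (y : Fin m → Y) => y i)
    (Measure.pi fun _ => ν) :=
  iIndepFun_pi (X := fun _ x => x) fun _ => aemeasurable_id

lemma map_pi_eval (i : Fin m) : (Measure.pi fun _ : Fin m => ν).map (fun y => y i) = ν :=
  (measurePreserving_eval (fun _ : Fin m => ν) i).map_eq

lemma map_pi_pair {i j : Fin m} (hij : i ≠ j) :
    (Measure.pi fun _ : Fin m => ν).map (fun y => (y i, y j)) = ν.prod ν := by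
  have h := (indepFun_iff_map_prod_eq_prod_map_map (measurable_pi_apply i).aemeasurable
    (measurable_pi_apply j).aemeasurable).1 ((iIndepFun_pi_eval (ν := ν) (m := m)).indepFun hij)
  rwa [map_pi_eval, map_pi_eval] at h

lemma map_pi_triple {i j k : Fin m} (hij : i ≠ j) (hik : i ≠ k) (hjk : j ≠ k) :
    (Measure.pi fun _ : Fin m => ν).map (fun y => (y i, y j, y k)) = ν.prod (ν.prod ν) := by
  have h := (indepFun_iff_map_prod_eq_prod_map_map (measurable_pi_apply i).aemeasurable
    (by fun_prop)).1
    ((iIndepFun_pi_eval (ν := ν) (m := m)).indepFun_prodMk (fun i => by fun_prop) j k i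
      hij.symm hik.symm).symm
  rwa [map_pi_eval, map_pi_pair hjk] at h

lemma integral_pi_pair {f : Y × Y → ℝ} (hf : BddMeas f) {i j : Fin m} (hij : i ≠ j) :
    ∫ y, f (y i, y j) ∂(Measure.pi fun _ : Fin m => ν) = ∫ q, f q ∂(ν.prod ν) := by
  rw [← map_pi_pair hij, integral_map (by fun_prop) hf.1.aestronglyMeasurable]

lemma integral_pi_triple {u v : Y × Y → ℝ} (hu : BddMeas u) (hv : BddMeas v) {i j k : Fin m}
    (hij : i ≠ j) (hik : i ≠ k) (hjk : j ≠ k) :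
    ∫ y, u (y i, y j) * v (y i, y k) ∂(Measure.pi fun _ : Fin m => ν) =
      ∫ x, (∫ y, u (x, y) ∂ν) * (∫ y, v (x, y) ∂ν) ∂ν := by
  have hF : BddMeas fun q : Y × Y × Y => u (q.1, q.2.1) * v (q.1, q.2.2) :=
    (hu.comp (by fun_prop)).mul (hv.comp (by fun_prop))
  have h := integral_map (μ := Measure.pi fun _ : Fin m => ν) (φ := fun y => (y i, y j, y k))
    (by fun_prop) hF.1.aestronglyMeasurable
  rw [← h, map_pi_triple hij hik hjk, integral_prod _ (hF.integrable _)]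
  refine integral_congr_ae (ae_of_all _ fun x => ?_)
  exact integral_prod_mul (fun y => u (x, y)) (fun y => v (x, y))

lemma integral_pi_quadruple {f : Y × Y → ℝ} (hf : BddMeas f) {i j k l : Fin m} (hij : i ≠ j)
    (hkl : k ≠ l) (hik : i ≠ k) (hil : i ≠ l) (hjk : j ≠ k) (hjl : j ≠ l) :
    ∫ y, f (y i, y j) * f (y k, y l) ∂(Measure.pi fun _ : Fin m => ν) =
      (∫ q, f q ∂(ν.prod ν)) ^ 2 := by
  have h := (iIndepFun_pi_eval (ν := ν) (m := m)).indepFun_prodMk_prodMk (fun i => by fun_prop)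
    i j k l hik hil hjk hjl
  have h2 := (h.comp hf.1 hf.1).integral_fun_mul_eq_mul_integral
    (hf.1.comp (by fun_prop)).aestronglyMeasurable (hf.1.comp (by fun_prop)).aestronglyMeasurable
  simp only [Function.comp_apply] at h2
  rw [h2, integral_pi_pair hf hij, integral_pi_pair hf hkl, pow_two]

/-- `∫ (∫ h(x, y) ν(dy))² ν(dx)`. -/
def rowSq (ν : Measure Y) (h : Y × Y → ℝ) : ℝ := ∫ x, (∫ y, h (x, y) ∂ν) ^ 2 ∂ν

omit [IsProbabilityMeasure ν] in
lemma rowSq_nonneg (h : Y × Y → ℝ) : 0 ≤ rowSq ν h := integral_nonneg fun _ => sq_nonneg _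

lemma BddMeas.swap {f : Y × Y → ℝ} (hf : BddMeas f) : BddMeas fun q : Y × Y => f q.swap :=
  hf.comp measurable_swap

lemma BddMeas.integral_right {f : Y × Y → ℝ} (hf : BddMeas f) :
    BddMeas fun x => ∫ y, f (x, y) ∂ν :=
  BddMeas.integral (κ := fun _ => ν) measurable_const hf

lemma integral_pi_triple_le {u v : Y × Y → ℝ} (hu : BddMeas u) (hv : BddMeas v) {i j k : Fin m}
    (hij : i ≠ j) (hik : i ≠ k) (hjk : j ≠ k) :
    ∫ y, u (y i, y j) * v (y i, y k) ∂(Measure.pi fun _ : Fin m => ν) ≤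
      (rowSq ν u + rowSq ν v) / 2 := by
  rw [integral_pi_triple hu hv hij hik hjk, rowSq, rowSq,
    ← integral_add (hu.integral_right.sq.integrable _) (hv.integral_right.sq.integrable _),
    ← integral_div]
  refine integral_mono ((hu.integral_right.mul hv.integral_right).integrable _)
    (((hu.integral_right.sq.add hv.integral_right.sq).integrable _).div_const 2) fun x => ?_
  dsimp only
  nlinarith [sq_nonneg ((∫ y, u (x, y) ∂ν) - ∫ y, v (x, y) ∂ν)]

lemma integral_sq_swap {f : Y × Y → ℝ} :
    ∫ q, f q.swap ^ 2 ∂(ν.prod ν) = ∫ q, f q ^ 2 ∂(ν.prod ν) :=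
  integral_prod_swap (fun q => f q ^ 2)

lemma abs_mul_integral_le {f h : Y × Y → ℝ} (hh : BddMeas h)
    (hfh : ∀ q, |f q| ≤ h q) (i j k l : Fin m) :
    ∫ y, f (y i, y j) * f (y k, y l) ∂(Measure.pi fun _ : Fin m => ν) ≤
      ∫ y, h (y i, y j) * h (y k, y l) ∂(Measure.pi fun _ : Fin m => ν) := by
  by_cases hint : Integrable (fun y : Fin m → Y => f (y i, y j) * f (y k, y l))
      (Measure.pi fun _ : Fin m => ν)
  · refine integral_mono hint (((hh.comp (by fun_prop)).mul (hh.comp (by fun_prop))).integrable _)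
      fun y => ?_
    refine (le_abs_self _).trans ?_
    rw [abs_mul]
    exact mul_le_mul (hfh _) (hfh _) (abs_nonneg _) ((abs_nonneg _).trans (hfh _))
  · rw [integral_undef hint]
    exact integral_nonneg fun y =>
      mul_nonneg ((abs_nonneg _).trans (hfh _)) ((abs_nonneg _).trans (hfh _))

lemma integral_pair_mul_pair_le {f h : Y × Y → ℝ} (hf : BddMeas f) (hh : BddMeas h)
    (hfh : ∀ q, |f q| ≤ h q) {p q : Fin m × Fin m} (hp : p.1 ≠ p.2) (hq : q.1 ≠ q.2) :
    ∫ y, f (y p.1, y p.2) * f (y q.1, y q.2) ∂(Measure.pi fun _ : Fin m => ν) ≤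
      (∫ q, f q ∂(ν.prod ν)) ^ 2 +
      ((if q.1 = p.1 then 1 else 0) + (if q.2 = p.1 then 1 else 0) +
        (if q.1 = p.2 then 1 else 0) + (if q.2 = p.2 then 1 else 0)) *
          (rowSq ν h + rowSq ν fun q => h q.swap) +
      ((if q = p then 1 else 0) + (if q = p.swap then 1 else 0)) *
          ∫ q, h q ^ 2 ∂(ν.prod ν) := by
  obtain ⟨i, j⟩ := p
  obtain ⟨k, l⟩ := q
  dsimp only [Prod.swap_prod_mk] at hp hq ⊢
  have hA := rowSq_nonneg (ν := ν) h
  have hB := rowSq_nonneg (ν := ν) fun q => h q.swap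
  have hC : 0 ≤ ∫ q, h q ^ 2 ∂(ν.prod ν) := integral_nonneg fun _ => sq_nonneg _
  have hM : 0 ≤ (∫ q, f q ∂(ν.prod ν)) ^ 2 := sq_nonneg _
  have hle := abs_mul_integral_le (ν := ν) (m := m) hh hfh i j k l
  have hs := hh.swap
  have hpos : ∀ (P : Prop) [Decidable P], (0 : ℝ) ≤ if P then 1 else 0 := fun P _ => by
    split_ifs <;> norm_num
  set A := rowSq ν h
  set B := rowSq ν fun q => h q.swap
  set C2 := ∫ q, h q ^ 2 ∂(ν.prod ν)
  have key : ∀ I J V : ℝ, 0 ≤ J → 1 ≤ I → V ≤ A + B →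
      V ≤ (∫ q, f q ∂(ν.prod ν)) ^ 2 + I * (A + B) + J * C2 := fun I J V hJ hI hV => by
    nlinarith [mul_nonneg hJ hC, mul_nonneg (sub_nonneg.2 hI) (add_nonneg hA hB)]
  have key' : ∀ I J V : ℝ, 0 ≤ I → 1 ≤ J → V ≤ C2 →
      V ≤ (∫ q, f q ∂(ν.prod ν)) ^ 2 + I * (A + B) + J * C2 := fun I J V hI hJ hV => by
    nlinarith [mul_nonneg hI (add_nonneg hA hB), mul_nonneg (sub_nonneg.2 hJ) hC]
  have h1 := hpos (k = i)
  have h2 := hpos (l = i)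
  have h3 := hpos (k = j)
  have h4 := hpos (l = j)
  have h5 := hpos ((k, l) = (i, j))
  have h6 := hpos ((k, l) = (j, i))
  by_cases hki : k = i
  · by_cases hlj : l = j
    · refine key' _ _ _ (by positivity) ?_ (hle.trans (le_of_eq ?_))
      · rw [if_pos (by rw [hki, hlj])]
        linarith
      · rw [hki, hlj]
        simp only [← pow_two]
        exact integral_pi_pair hh.sq hp
    · refine key _ _ _ (by positivity) ?_ (hle.trans ?_)
      · rw [if_pos hki]
        linarith
      · have := integral_pi_triple_le (ν := ν) hh hh hp (hki ▸ hq) (Ne.symm hlj)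
        rw [hki]
        linarith
  by_cases hlj : l = j
  · refine key _ _ _ (by positivity) ?_ (hle.trans ?_)
    · rw [if_pos hlj]
      linarith
    · have := integral_pi_triple_le (ν := ν) hs hs hp.symm (hlj ▸ hq.symm) (Ne.symm hki)
      rw [hlj]
      simp only [Prod.swap_prod_mk] at this
      linarith
  by_cases hkj : k = j
  · by_cases hli : l = i
    · refine key' _ _ _ (by positivity) ?_ (hle.trans ?_)
      · rw [if_pos (show (k, l) = (j, i) by rw [hkj, hli])]
        linarith
      · rw [hkj, hli]
        have e1 := integral_pi_pair (ν := ν) hh.sq hp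
        have e2 := integral_pi_pair (ν := ν) hh.sq hp.symm
        have i1 := ((hh.sq.comp (g := fun y : Fin m → Y => (y i, y j)) (by fun_prop))).integrable
          (Measure.pi fun _ : Fin m => ν)
        have i2 := ((hh.sq.comp (g := fun y : Fin m → Y => (y j, y i)) (by fun_prop))).integrable
          (Measure.pi fun _ : Fin m => ν)
        calc _ ≤ ∫ y, (h (y i, y j) ^ 2 + h (y j, y i) ^ 2) / 2
                ∂(Measure.pi fun _ : Fin m => ν) :=
              integral_mono (((hh.comp (by fun_prop)).mul (hh.comp (by fun_prop))).integrable _)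
                ((i1.add i2).div_const 2) fun y => by
                  dsimp only
                  nlinarith [sq_nonneg (h (y i, y j) - h (y j, y i))]
          _ = C2 := by
              rw [integral_div, integral_add i1 i2, e1, e2]
              ring
    · refine key _ _ _ (by positivity) ?_ (hle.trans ?_)
      · rw [if_pos hkj]
        linarith
      · have := integral_pi_triple_le (ν := ν) hs hh hp.symm (hkj ▸ hq) (Ne.symm hli)
        rw [hkj]
        simp only [Prod.swap_prod_mk] at this
        linarith
  by_cases hli : l = i
  · refine key _ _ _ (by positivity) ?_ (hle.trans ?_)
    · rw [if_pos hli]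
      linarith
    · have := integral_pi_triple_le (ν := ν) hh hs hp (hli ▸ hq.symm) (Ne.symm hkj)
      rw [hli]
      simp only [Prod.swap_prod_mk] at this
      linarith
  · rw [integral_pi_quadruple hf hp hq (Ne.symm hki) (Ne.symm hli) (Ne.symm hkj) (Ne.symm hlj)]
    have : 0 ≤ A + B := add_nonneg hA hB
    have : 0 ≤ C2 := hC
    refine le_add_of_le_of_nonneg (le_add_of_nonneg_right ?_) ?_ <;> positivity

lemma sum_offDiag_eq {F : Fin m × Fin m → ℝ} :
    ∑ p ∈ Finset.univ.offDiag, F p = ∑ i, ∑ j, if i ≠ j then F (i, j) else 0 := by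
  rw [← Fintype.sum_prod_type', ← Finset.sum_filter]
  refine Finset.sum_congr ?_ fun _ _ => rfl
  ext p
  simp

lemma integral_sum_offDiag {f : Y × Y → ℝ} (hf : BddMeas f) :
    ∫ y, ∑ p ∈ Finset.univ.offDiag, f (y p.1, y p.2) ∂(Measure.pi fun _ : Fin m => ν) =
      (m * (m - 1) : ℝ) * ∫ q, f q ∂(ν.prod ν) := by
  rw [integral_finsetSum _ fun p _ => (hf.comp (by fun_prop)).integrable _,
    Finset.sum_congr rfl fun p hp => integral_pi_pair hf (Finset.mem_offDiag.1 hp).2.2,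
    Finset.sum_const, Finset.offDiag_card, nsmul_eq_mul]
  congr 1
  rw [Finset.card_univ, Fintype.card_fin, Nat.cast_sub (Nat.le_mul_self m)]
  push_cast
  ring

lemma integral_sq_sum_offDiag_le {f h : Y × Y → ℝ} (hf : BddMeas f) (hh : BddMeas h)
    (hfh : ∀ q, |f q| ≤ h q) :
    ∫ y, (∑ p ∈ Finset.univ.offDiag, f (y p.1, y p.2)) ^ 2 ∂(Measure.pi fun _ : Fin m => ν) ≤
      (m * (m - 1) : ℝ) ^ 2 * (∫ q, f q ∂(ν.prod ν)) ^ 2 +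
      4 * (m * (m - 1) ^ 2 : ℝ) * (rowSq ν h + rowSq ν fun q => h q.swap) +
      2 * (m * (m - 1) : ℝ) * ∫ q, h q ^ 2 ∂(ν.prod ν) := by
  have hcard : (((Finset.univ : Finset (Fin m)).offDiag.card : ℕ) : ℝ) = m * (m - 1) := by
    rw [Finset.offDiag_card, Finset.card_univ, Fintype.card_fin,
      Nat.cast_sub (Nat.le_mul_self m)]
    push_cast
    ring
  have hite : ∀ (P : Prop) [Decidable P], (if P then (0 : ℝ) else 1) = 1 - if P then 1 else 0 :=
    fun P _ => by split_ifs <;> simp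
  have hfst : ∀ a : Fin m, ∑ q ∈ Finset.univ.offDiag, (if q.1 = a then (1 : ℝ) else 0) =
      m - 1 := fun a => by
    rw [sum_offDiag_eq, Finset.sum_eq_single a (fun i _ hi => by simp [hi]) (by simp)]
    simp [hite]
  have hsnd : ∀ a : Fin m, ∑ q ∈ Finset.univ.offDiag, (if q.2 = a then (1 : ℝ) else 0) =
      m - 1 := fun a => by
    rw [sum_offDiag_eq, Finset.sum_comm,
      Finset.sum_eq_single a (fun i _ hi => by simp [hi]) (by simp)]
    simp [hite]
  simp only [pow_two (∑ p ∈ Finset.univ.offDiag, _), Finset.sum_mul_sum]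
  have hi : ∀ p q : Fin m × Fin m, Integrable (fun y : Fin m → Y =>
      f (y p.1, y p.2) * f (y q.1, y q.2)) (Measure.pi fun _ : Fin m => ν) := fun p q =>
    ((hf.comp (by fun_prop)).mul (hf.comp (by fun_prop))).integrable _
  rw [integral_finsetSum _ fun p _ => integrable_finsetSum _ fun q _ => hi p q]
  simp only [integral_finsetSum _ fun q _ => hi _ q]
  refine (Finset.sum_le_sum fun p hp => Finset.sum_le_sum fun q hq =>
    integral_pair_mul_pair_le hf hh hfh (Finset.mem_offDiag.1 hp).2.2
      (Finset.mem_offDiag.1 hq).2.2).trans (le_of_eq ?_)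
  have hin : ∀ p ∈ (Finset.univ : Finset (Fin m)).offDiag, ∀ M V C : ℝ,
      ∑ q ∈ Finset.univ.offDiag, (M + ((if q.1 = p.1 then 1 else 0) + (if q.2 = p.1 then 1 else 0) +
        (if q.1 = p.2 then 1 else 0) + (if q.2 = p.2 then 1 else 0)) * V +
        ((if q = p then 1 else 0) + (if q = p.swap then 1 else 0)) * C) =
      (m * (m - 1) : ℝ) * M + 4 * (m - 1) * V + 2 * C := fun p hp M V C => by
    have hp' : p.swap ∈ (Finset.univ : Finset (Fin m)).offDiag := by
      simpa [eq_comm] using hp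
    simp only [Finset.sum_add_distrib, ← Finset.sum_mul, hfst, hsnd, Finset.sum_ite_eq',
      Finset.sum_const, nsmul_eq_mul, hcard, if_pos hp, if_pos hp']
    ring
  rw [Finset.sum_congr rfl fun p hp => hin p hp _ _ _, Finset.sum_const, nsmul_eq_mul, hcard]
  ring

lemma integral_sq_sum_erase_le {h : Y × Y → ℝ} (hh : BddMeas h) (i : Fin m) :
    ∫ y, (∑ j ∈ Finset.univ.erase i, h (y i, y j)) ^ 2 ∂(Measure.pi fun _ : Fin m => ν) ≤
      (m - 1 : ℝ) ^ 2 * rowSq ν h + (m - 1 : ℝ) * ∫ q, h q ^ 2 ∂(ν.prod ν) := by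
  have hC : 0 ≤ ∫ q, h q ^ 2 ∂(ν.prod ν) := integral_nonneg fun _ => sq_nonneg _
  have hcard : (((Finset.univ : Finset (Fin m)).erase i).card : ℝ) = m - 1 := by
    rw [Finset.card_erase_of_mem (Finset.mem_univ i), Finset.card_univ, Fintype.card_fin,
      Nat.cast_pred (i.pos)]
  simp only [pow_two (∑ j ∈ Finset.univ.erase i, _), Finset.sum_mul_sum]
  have hi : ∀ p q : Fin m, Integrable (fun y : Fin m → Y =>
      h (y i, y p) * h (y i, y q)) (Measure.pi fun _ : Fin m => ν) := fun p q =>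
    ((hh.comp (by fun_prop)).mul (hh.comp (by fun_prop))).integrable _
  rw [integral_finsetSum _ fun p _ => integrable_finsetSum _ fun q _ => hi p q]
  simp only [integral_finsetSum _ fun q _ => hi _ q]
  have hle : ∀ p ∈ Finset.univ.erase i, ∀ q ∈ Finset.univ.erase i,
      ∫ y, h (y i, y p) * h (y i, y q) ∂(Measure.pi fun _ : Fin m => ν) ≤
        rowSq ν h + (if q = p then 1 else 0) * ∫ q, h q ^ 2 ∂(ν.prod ν) := fun p hp q hq => by
    by_cases hqp : q = p
    · subst hqp
      simp only [← pow_two]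
      rw [integral_pi_pair hh.sq (Finset.ne_of_mem_erase hp).symm, if_pos trivial, one_mul]
      exact le_add_of_nonneg_left (rowSq_nonneg h)
    · rw [if_neg hqp, zero_mul, add_zero]
      refine (integral_pi_triple_le hh hh (Finset.ne_of_mem_erase hp).symm
        (Finset.ne_of_mem_erase hq).symm (Ne.symm hqp)).trans (le_of_eq ?_)
      ring
  refine (Finset.sum_le_sum fun p hp => Finset.sum_le_sum fun q hq => hle p hp q hq).trans
    (le_of_eq ?_)
  have hin : ∀ p ∈ (Finset.univ : Finset (Fin m)).erase i, ∀ V C : ℝ,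
      ∑ q ∈ Finset.univ.erase i, (V + (if q = p then 1 else 0) * C) = (m - 1 : ℝ) * V + C :=
    fun p hp V C => by
      simp only [Finset.sum_add_distrib, ← Finset.sum_mul, Finset.sum_ite_eq', Finset.sum_const,
        nsmul_eq_mul, hcard, if_pos hp, one_mul]
  rw [Finset.sum_congr rfl fun p hp => hin p hp _ _, Finset.sum_const, nsmul_eq_mul, hcard]
  ring

end IndependentSample

section Weights

/-- Weights of the pairs of particles in a new generation of size `N`, given the weights `h` of
their parents, when the coincidence of the two lineages is prescribed by `b`. -/
def stepW (b : Bool) (N : ℕ) (h : ℕ → ℕ → ℝ) (i j : ℕ) : ℝ :=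
  if i < N ∧ j < N ∧ (i = j ↔ b = true) then
    (if b then (N : ℝ)⁻¹ else ((N : ℝ) * ((N : ℝ) - 1))⁻¹) * h i j
  else 0

/-- Contribution of the parents `k, l` to the weight of their offspring; when the two lineages
coincide, the second parent is resampled with weights `g`. -/
def parentW (b : Bool) (N : ℕ) (g : ℕ → ℝ) (T : ℕ → ℕ → ℝ) (k l : ℕ) : ℝ :=
  if b then (∑ j ∈ Finset.range N, g j) * ∑ l' ∈ Finset.range N, T k l' * g l'
  else (∑ j ∈ Finset.range N, g j) ^ 2 * T k l

/-- Weight of the pair of particles `(i, j)` of generation `p` in `μ_b^N`. -/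
def pairW (b : ℕ → Bool) (G : ℕ → X → ℝ) (Np : ℕ → ℕ) :
    ℕ → ((ℕ → ℕ → X) × (ℕ → ℕ → ℕ)) → ℕ → ℕ → ℝ
  | 0 => fun _ => stepW (b 0) (Np 0) fun _ _ => 1
  | p + 1 => fun ω => stepW (b (p + 1)) (Np (p + 1)) fun i j =>
      parentW (b (p + 1)) (Np p) (fun k => G p (ω.1 p k)) (pairW b G Np p ω) (ω.2 p i) (ω.2 p j)

/-- Sum of the squared row and column sums of `T`, normalized by `N`. -/
def margSq (N : ℕ) (T : ℕ → ℕ → ℝ) : ℝ :=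
  N * ∑ k ∈ Finset.range N, (∑ l ∈ Finset.range N, T k l) ^ 2 +
    N * ∑ l ∈ Finset.range N, (∑ k ∈ Finset.range N, T k l) ^ 2

/-- `φ` evaluated on the diagonal if `b`. -/
def diagIf (b : Bool) (φ : X × X → ℝ) (q : X × X) : ℝ := if b then φ (q.1, q.1) else φ q

lemma margSq_nonneg (N : ℕ) (T : ℕ → ℕ → ℝ) : 0 ≤ margSq N T := by
  unfold margSq
  positivity

lemma diagIf_bddMeas (b : Bool) {φ : X × X → ℝ} (hφ : BddMeas φ) : BddMeas (diagIf b φ) := by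
  cases b
  · have : diagIf false φ = φ := by ext; simp [diagIf]
    rwa [this]
  · have : diagIf true φ = fun q => φ (q.1, q.1) := by ext; simp [diagIf]
    rw [this]
    exact hφ.comp (by fun_prop)

omit [MeasurableSpace X] in
lemma abs_diagIf_le (b : Bool) {φ : X × X → ℝ} {C : ℝ} (hC : ∀ q, |φ q| ≤ C) (q : X × X) :
    |diagIf b φ q| ≤ C := by
  unfold diagIf
  split_ifs <;> exact hC _

variable {b : Bool} {N : ℕ} {h : ℕ → ℕ → ℝ}

lemma sum_stepW_mul (hN : 2 ≤ N) (hb : b = true → ∀ i j, h i j = h i i) (ψ : ℕ → ℕ → ℝ)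
    (i : Fin N) :
    ∑ j ∈ Finset.range N, stepW b N h i j * ψ i j =
      ((N : ℝ) * ((N : ℝ) - 1))⁻¹ * ∑ j ∈ Finset.univ.erase i,
        h i j * (if b then ψ i i else ψ i (j : ℕ)) := by
  have hN' : (2 : ℝ) ≤ N := by exact_mod_cast hN
  have hN1 : (N : ℝ) - 1 ≠ 0 := by linarith
  have hN0 : (N : ℝ) ≠ 0 := by linarith
  have hcard : (((Finset.univ : Finset (Fin N)).erase i).card : ℝ) = N - 1 := by
    rw [Finset.card_erase_of_mem (Finset.mem_univ i), Finset.card_univ, Fintype.card_fin,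
      Nat.cast_pred (i.pos)]
  rw [Finset.sum_range]
  cases b
  · simp only [stepW, i.2, Fin.is_lt, true_and, Bool.false_eq_true, iff_false, if_false,
      Finset.mul_sum, Fin.val_inj, ite_mul, zero_mul]
    rw [← Finset.sum_filter]
    refine Finset.sum_congr (by ext; simp [eq_comm]) fun j _ => by ring
  · simp only [stepW, i.2, Fin.is_lt, true_and, iff_true, if_true, Fin.val_inj, ite_mul, zero_mul,
      Finset.sum_ite_eq, Finset.mem_univ]
    simp only [hb rfl (i : ℕ) _, Finset.sum_const, nsmul_eq_mul, hcard]
    field_simp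

lemma sum_sum_stepW_mul (hN : 2 ≤ N) (hb : b = true → ∀ i j, h i j = h i i) (ψ : ℕ → ℕ → ℝ) :
    ∑ i ∈ Finset.range N, ∑ j ∈ Finset.range N, stepW b N h i j * ψ i j =
      ((N : ℝ) * ((N : ℝ) - 1))⁻¹ * ∑ p ∈ (Finset.univ : Finset (Fin N)).offDiag,
        h p.1 p.2 * (if b then ψ p.1 p.1 else ψ p.1 p.2) := by
  rw [Finset.sum_range, sum_offDiag_eq, Finset.mul_sum]
  refine Finset.sum_congr rfl fun i _ => ?_
  rw [sum_stepW_mul hN hb, ← Finset.sum_filter]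
  congr 1
  exact Finset.sum_congr (by ext; simp [eq_comm]) fun _ _ => rfl

lemma sum_stepW_row (hN : 2 ≤ N) (hb : b = true → ∀ i j, h i j = h i i) (i : Fin N) :
    ∑ j ∈ Finset.range N, stepW b N h i j =
      ((N : ℝ) * ((N : ℝ) - 1))⁻¹ * ∑ j ∈ Finset.univ.erase i, h i (j : ℕ) := by
  simpa using sum_stepW_mul hN hb (fun _ _ => 1) i

lemma stepW_swap (hb : b = true → ∀ i j, h i j = h i i) (i j : ℕ) :
    stepW b N h i j = stepW b N (fun i j => if b then h i j else h j i) j i := by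
  unfold stepW
  by_cases hij : i = j
  · subst hij
    cases b <;> simp
  · cases b <;> simp [hij, Ne.symm hij, and_comm]

lemma sum_stepW_col (hN : 2 ≤ N) (hb : b = true → ∀ i j, h i j = h i i) (j : Fin N) :
    ∑ i ∈ Finset.range N, stepW b N h i j =
      ((N : ℝ) * ((N : ℝ) - 1))⁻¹ * ∑ i ∈ Finset.univ.erase j,
        if b then h j (i : ℕ) else h (i : ℕ) j := by
  simp only [stepW_swap hb _ (j : ℕ)]
  refine sum_stepW_row hN (fun hb' i j => ?_) j
  simpa [hb'] using hb hb' i j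

lemma stepW_nonneg (hN : 1 ≤ N) (hh : ∀ i j, 0 ≤ h i j) (i j : ℕ) : 0 ≤ stepW b N h i j := by
  have hN' : (1 : ℝ) ≤ N := by exact_mod_cast hN
  unfold stepW
  split_ifs
  · exact mul_nonneg (by positivity) (hh i j)
  · exact mul_nonneg (inv_nonneg.2 (mul_nonneg (by linarith) (by linarith))) (hh i j)
  · rfl

lemma margSq_stepW_one (hN : 2 ≤ N) : margSq N (stepW b N fun _ _ => 1) = 2 := by
  have hN' : (2 : ℝ) ≤ N := by exact_mod_cast hN
  have hN1 : (N : ℝ) - 1 ≠ 0 := by linarith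
  have hN0 : (N : ℝ) ≠ 0 := by linarith
  have hb : b = true → ∀ i j : ℕ, (fun _ _ => 1 : ℕ → ℕ → ℝ) i j = (fun _ _ => 1) i i :=
    fun _ _ _ => rfl
  have hcard : ∀ i : Fin N, (((Finset.univ : Finset (Fin N)).erase i).card : ℝ) = N - 1 :=
      fun i => by
    rw [Finset.card_erase_of_mem (Finset.mem_univ i), Finset.card_univ, Fintype.card_fin,
      Nat.cast_pred (i.pos)]
  unfold margSq
  rw [Finset.sum_range, Finset.sum_range]
  simp only [sum_stepW_row hN hb, sum_stepW_col hN hb, ite_self, Finset.sum_const, nsmul_eq_mul,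
    hcard, Finset.card_univ, Fintype.card_fin]
  field_simp
  ring

lemma parentW_true {g : ℕ → ℝ} {T : ℕ → ℕ → ℝ} (hb : b = true) (k l l' : ℕ) :
    parentW b N g T k l = parentW b N g T k l' := by
  simp [parentW, hb]

lemma parentW_nonneg {g : ℕ → ℝ} {T : ℕ → ℕ → ℝ} (hg : ∀ k, 0 ≤ g k) (hT : ∀ k l, 0 ≤ T k l)
    (k l : ℕ) : 0 ≤ parentW b N g T k l := by
  unfold parentW
  split_ifs
  · exact mul_nonneg (Finset.sum_nonneg fun _ _ => hg _)
      (Finset.sum_nonneg fun _ _ => mul_nonneg (hT _ _) (hg _))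
  · exact mul_nonneg (sq_nonneg _) (hT _ _)

section ParentBounds

variable {g : ℕ → ℝ} {T : ℕ → ℕ → ℝ} {Cg : ℝ}

lemma sum_weight_parentW_row_le (hgC : ∀ k, g k ≤ Cg) (hT : ∀ k l, 0 ≤ T k l)
    (hS : 0 < ∑ j ∈ Finset.range N, g j) (k : ℕ) :
    ∑ l ∈ Finset.range N, (g l / ∑ j ∈ Finset.range N, g j) * parentW b N g T k l ≤
      (∑ j ∈ Finset.range N, g j) * (Cg * ∑ l ∈ Finset.range N, T k l) := by
  have hle : ∑ l ∈ Finset.range N, T k l * g l ≤ Cg * ∑ l ∈ Finset.range N, T k l := by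
    rw [Finset.mul_sum]
    exact Finset.sum_le_sum fun l _ => by nlinarith [hT k l, hgC l]
  refine le_trans (le_of_eq ?_) (mul_le_mul_of_nonneg_left hle hS.le)
  cases b
  · simp only [parentW, Bool.false_eq_true, if_false]
    rw [Finset.mul_sum]
    refine Finset.sum_congr rfl fun l _ => ?_
    field_simp
  · simp only [parentW, if_true]
    rw [← Finset.sum_mul, ← Finset.sum_div, div_self hS.ne', one_mul]

lemma sum_weight_sq_le (hg : ∀ k, 0 ≤ g k) (hgC : ∀ k, g k ≤ Cg)
    (hS : 0 < ∑ j ∈ Finset.range N, g j) {r t : ℕ → ℝ} (hr : ∀ k, 0 ≤ r k)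
    (hrt : ∀ k, r k ≤ (∑ j ∈ Finset.range N, g j) * (Cg * t k)) :
    ∑ k ∈ Finset.range N, (g k / ∑ j ∈ Finset.range N, g j) * r k ^ 2 ≤
      Cg ^ 4 * (N * ∑ k ∈ Finset.range N, t k ^ 2) := by
  have hC : 0 ≤ Cg := (hg 0).trans (hgC 0)
  have hSN : ∑ j ∈ Finset.range N, g j ≤ N * Cg := by
    refine (Finset.sum_le_sum fun j _ => hgC j).trans (le_of_eq ?_)
    simp
  set S := ∑ j ∈ Finset.range N, g j
  have hk : ∀ k, g k / S * r k ^ 2 ≤ Cg ^ 4 * (N * t k ^ 2) := fun k => by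
    calc g k / S * r k ^ 2 ≤ g k / S * (S * (Cg * t k)) ^ 2 := by
          have := pow_le_pow_left₀ (hr k) (hrt k) 2
          have := div_nonneg (hg k) hS.le
          gcongr
      _ = g k * S * (Cg ^ 2 * t k ^ 2) := by field_simp
      _ ≤ Cg * (N * Cg) * (Cg ^ 2 * t k ^ 2) := by
          have := mul_le_mul (hgC k) hSN hS.le hC
          gcongr
      _ = _ := by ring
  refine (Finset.sum_le_sum fun k _ => hk k).trans (le_of_eq ?_)
  rw [Finset.mul_sum, Finset.mul_sum]

lemma sum_weight_row_sq_le (hg : ∀ k, 0 ≤ g k) (hgC : ∀ k, g k ≤ Cg) (hT : ∀ k l, 0 ≤ T k l)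
    (hS : 0 < ∑ j ∈ Finset.range N, g j) :
    ∑ k ∈ Finset.range N, (g k / ∑ j ∈ Finset.range N, g j) *
      (∑ l ∈ Finset.range N, (g l / ∑ j ∈ Finset.range N, g j) * parentW b N g T k l) ^ 2 ≤
      Cg ^ 4 * (N * ∑ k ∈ Finset.range N, (∑ l ∈ Finset.range N, T k l) ^ 2) :=
  sum_weight_sq_le hg hgC hS
    (fun k => Finset.sum_nonneg fun l _ =>
      mul_nonneg (div_nonneg (hg l) hS.le) (parentW_nonneg hg hT k l))
    fun k => sum_weight_parentW_row_le hgC hT hS k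

lemma row_le_margSq : N * ∑ k ∈ Finset.range N, (∑ l ∈ Finset.range N, T k l) ^ 2 ≤ margSq N T :=
  le_add_of_nonneg_right (by positivity)

lemma col_le_margSq : N * ∑ l ∈ Finset.range N, (∑ k ∈ Finset.range N, T k l) ^ 2 ≤ margSq N T :=
  le_add_of_nonneg_left (by positivity)

lemma sq_sum_weight_le (hg : ∀ k, 0 ≤ g k) (hS : 0 < ∑ j ∈ Finset.range N, g j) {r : ℕ → ℝ}
    (hr : ∀ k, 0 ≤ r k) :
    (∑ k ∈ Finset.range N, (g k / ∑ j ∈ Finset.range N, g j) * r k) ^ 2 ≤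
      ∑ k ∈ Finset.range N, (g k / ∑ j ∈ Finset.range N, g j) * r k ^ 2 :=
  Real.pow_arith_mean_le_arith_mean_pow _ _ _ (fun k _ => div_nonneg (hg k) hS.le)
    (by rw [← Finset.sum_div, div_self hS.ne']) (fun k _ => hr k) 2

lemma sum_weight_col_sq_le (hg : ∀ k, 0 ≤ g k) (hgC : ∀ k, g k ≤ Cg) (hT : ∀ k l, 0 ≤ T k l)
    (hS : 0 < ∑ j ∈ Finset.range N, g j) :
    ∑ l ∈ Finset.range N, (g l / ∑ j ∈ Finset.range N, g j) *
      (∑ k ∈ Finset.range N, (g k / ∑ j ∈ Finset.range N, g j) * parentW b N g T k l) ^ 2 ≤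
      Cg ^ 4 * margSq N T := by
  have hC : 0 ≤ Cg := (hg 0).trans (hgC 0)
  have hw : ∑ k ∈ Finset.range N, (g k / ∑ j ∈ Finset.range N, g j) = 1 := by
    rw [← Finset.sum_div, div_self hS.ne']
  cases b
  · refine le_trans ?_ (mul_le_mul_of_nonneg_left (col_le_margSq (N := N) (T := T)) (by positivity))
    exact sum_weight_row_sq_le (b := false) (T := fun k l => T l k) hg hgC (fun k l => hT l k) hS
  · refine le_trans ?_ (mul_le_mul_of_nonneg_left (row_le_margSq (N := N) (T := T)) (by positivity))
    have h1 := sum_weight_row_sq_le (b := true) (T := T) hg hgC hT hS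
    have h2 := sq_sum_weight_le hg hS (r := fun k => parentW true N g T k 0)
      fun k => parentW_nonneg hg hT k 0
    simp only [parentW_true (b := true) rfl _ _ 0, ← Finset.sum_mul, hw, one_mul] at h1 h2 ⊢
    exact h2.trans h1

lemma sum_weight_sum_sq_le (hg : ∀ k, 0 ≤ g k) (hgC : ∀ k, g k ≤ Cg) (hT : ∀ k l, 0 ≤ T k l)
    (hS : 0 < ∑ j ∈ Finset.range N, g j) :
    ∑ k ∈ Finset.range N, (g k / ∑ j ∈ Finset.range N, g j) *
      ∑ l ∈ Finset.range N, (g l / ∑ j ∈ Finset.range N, g j) * parentW b N g T k l ^ 2 ≤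
      N * (Cg ^ 4 * margSq N T) := by
  have hC : 0 ≤ Cg := (hg 0).trans (hgC 0)
  have hN : (1 : ℝ) ≤ N := by
    rcases Nat.eq_zero_or_pos N with rfl | h
    · simp at hS
    · exact_mod_cast h
  have hw : ∑ k ∈ Finset.range N, (g k / ∑ j ∈ Finset.range N, g j) = 1 := by
    rw [← Finset.sum_div, div_self hS.ne']
  have hm := margSq_nonneg N T
  cases b
  · have hSN : ∑ j ∈ Finset.range N, g j ≤ N * Cg := by
      refine (Finset.sum_le_sum fun j _ => hgC j).trans (le_of_eq ?_)
      simp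
    refine le_trans ?_ (mul_le_mul_of_nonneg_left (mul_le_mul_of_nonneg_left
      (row_le_margSq (N := N) (T := T)) (by positivity)) (by positivity))
    set S := ∑ j ∈ Finset.range N, g j
    have hkl : ∀ k l, g k / S * (g l / S * parentW false N g T k l ^ 2) ≤
        N ^ 2 * Cg ^ 4 * T k l ^ 2 := fun k l => by
      calc _ = g k * g l * S ^ 2 * T k l ^ 2 := by
            simp only [parentW, Bool.false_eq_true, if_false]
            change g k / S * (g l / S * (S ^ 2 * T k l) ^ 2) = _
            field_simp
        _ ≤ Cg * Cg * (N * Cg) ^ 2 * T k l ^ 2 := by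
            have h1 := mul_le_mul (hgC k) (hgC l) (hg l) hC
            have h2 := pow_le_pow_left₀ hS.le hSN 2
            gcongr
        _ = _ := by ring
    calc _ ≤ ∑ k ∈ Finset.range N, ∑ l ∈ Finset.range N, N ^ 2 * Cg ^ 4 * T k l ^ 2 := by
          refine Finset.sum_le_sum fun k _ => ?_
          rw [Finset.mul_sum]
          exact Finset.sum_le_sum fun l _ => hkl k l
      _ ≤ ∑ k ∈ Finset.range N, N ^ 2 * Cg ^ 4 * (∑ l ∈ Finset.range N, T k l) ^ 2 := by
          refine Finset.sum_le_sum fun k _ => ?_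
          rw [← Finset.mul_sum]
          have := Finset.sum_sq_le_sq_sum_of_nonneg (s := Finset.range N) (f := T k)
            fun l _ => hT k l
          gcongr
      _ = _ := by
          rw [← Finset.mul_sum]
          ring
  · have h1 := sum_weight_row_sq_le (b := true) (T := T) hg hgC hT hS
    simp only [parentW_true (b := true) rfl _ _ 0, ← Finset.sum_mul, hw, one_mul] at h1 ⊢
    refine h1.trans ((mul_le_mul_of_nonneg_left (row_le_margSq (N := N) (T := T))
      (by positivity)).trans (le_mul_of_one_le_left (by positivity) hN))

end ParentBounds

end Weights

section OneStep

lemma cat_apply_univ {N : ℕ} {g : ℕ → ℝ} (hg : ∀ k, 0 ≤ g k)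
    (hS : 0 < ∑ j ∈ Finset.range N, g j) : cat N g Set.univ = 1 := by
  have h : ∑ j ∈ Finset.range N, ENNReal.ofReal (g j) =
      ENNReal.ofReal (∑ j ∈ Finset.range N, g j) :=
    (ENNReal.ofReal_sum_of_nonneg fun j _ => hg j).symm
  simp only [cat, Measure.smul_apply, Measure.finsetSum_apply, smul_eq_mul, measure_univ, mul_one]
  rw [h]
  exact ENNReal.inv_mul_cancel (by simpa using hS) ENNReal.ofReal_ne_top

lemma isProbabilityMeasure_cat {N : ℕ} {g : ℕ → ℝ} (hg : ∀ k, 0 ≤ g k)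
    (hS : 0 < ∑ j ∈ Finset.range N, g j) : IsProbabilityMeasure (cat N g) :=
  ⟨cat_apply_univ hg hS⟩

lemma integral_cat {N : ℕ} {g : ℕ → ℝ} (hg : ∀ k, 0 ≤ g k) (f : ℕ → ℝ) :
    ∫ k, f k ∂(cat N g) =
      ∑ k ∈ Finset.range N, (g k / ∑ j ∈ Finset.range N, g j) * f k := by
  have h : ∑ j ∈ Finset.range N, ENNReal.ofReal (g j) =
      ENNReal.ofReal (∑ j ∈ Finset.range N, g j) :=
    (ENNReal.ofReal_sum_of_nonneg fun j _ => hg j).symm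
  have hi : ∀ j, Integrable f (ENNReal.ofReal (g j) • Measure.dirac j) := fun j =>
    (integrable_dirac (by simp)).smul_measure ENNReal.ofReal_ne_top
  rw [cat, h, integral_smul_measure, integral_finsetSum_measure fun j _ => hi j, smul_eq_mul,
    ENNReal.toReal_inv, ENNReal.toReal_ofReal (Finset.sum_nonneg fun j _ => hg j), Finset.mul_sum]
  refine Finset.sum_congr rfl fun j _ => ?_
  rw [integral_smul_measure, integral_dirac, ENNReal.toReal_ofReal (hg j), smul_eq_mul]
  ring

/-- Joint law of the ancestor index and the position of a new particle. -/
def moveLaw (N : ℕ) (g : X → ℝ) (K : Kernel X X) (z : ℕ → X) : Measure (ℕ × X) :=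
  (cat N fun j => g (z j)).bind fun a => (K (z a)).map fun x => (a, x)

variable {N : ℕ} {g : X → ℝ} {K : Kernel X X} [IsMarkovKernel K]

omit [MeasurableSpace X] in
lemma sum_weight_pos (hN : 1 ≤ N) (hg : ∀ x, 0 < g x) (z : ℕ → X) :
    0 < ∑ j ∈ Finset.range N, g (z j) :=
  Finset.sum_pos (fun _ _ => hg _) (by simpa using Nat.pos_iff_ne_zero.1 hN)

lemma isProbabilityMeasure_moveLaw (hN : 1 ≤ N) (hg : ∀ x, 0 < g x) (z : ℕ → X) :
    IsProbabilityMeasure (moveLaw N g K z) := by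
  have := isProbabilityMeasure_cat (fun j => (hg (z j)).le) (sum_weight_pos hN hg z)
  have hp : ∀ a, IsProbabilityMeasure ((K (z a)).map fun x => (a, x)) := fun a =>
    Measure.isProbabilityMeasure_map (by fun_prop)
  exact isProbabilityMeasure_bind_of_forall measurable_from_top

lemma integral_moveLaw (hN : 1 ≤ N) (hg : ∀ x, 0 < g x) (z : ℕ → X) {f : ℕ × X → ℝ}
    (hf : BddMeas f) :
    ∫ y, f y ∂(moveLaw N g K z) = ∑ k ∈ Finset.range N,
      (g (z k) / ∑ j ∈ Finset.range N, g (z j)) * ∫ x, f (k, x) ∂(K (z k)) := by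
  have := isProbabilityMeasure_cat (fun j => (hg (z j)).le) (sum_weight_pos hN hg z)
  have hp : ∀ a, IsProbabilityMeasure ((K (z a)).map fun x => (a, x)) := fun a =>
    Measure.isProbabilityMeasure_map (by fun_prop)
  rw [moveLaw, integral_bind_of_bddMeas measurable_from_top hf,
    integral_cat fun j => (hg (z j)).le]
  refine Finset.sum_congr rfl fun k _ => ?_
  rw [integral_map (by fun_prop) hf.1.aestronglyMeasurable]

omit [IsMarkovKernel K] in
lemma measurable_moveLaw (hgm : Measurable g) :
    Measurable (moveLaw N g K) := by
  refine Measure.measurable_of_measurable_coe _ fun s hs => ?_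
  have : ∀ z, moveLaw N g K z s = (∑ j ∈ Finset.range N, ENNReal.ofReal (g (z j)))⁻¹ *
      ∑ j ∈ Finset.range N, ENNReal.ofReal (g (z j)) * K (z j) (Prod.mk j ⁻¹' s) := fun z => by
    rw [moveLaw, Measure.bind_apply hs measurable_from_top.aemeasurable, cat,
      lintegral_smul_measure,
      lintegral_finsetSum_measure, smul_eq_mul]
    congr 1
    refine Finset.sum_congr rfl fun j _ => ?_
    rw [lintegral_smul_measure, lintegral_dirac, Measure.map_apply (by fun_prop) hs, smul_eq_mul]
  simp only [this]
  refine Measurable.mul (Measurable.inv (Finset.measurable_sum _ fun j _ => by fun_prop))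
    (Finset.measurable_sum _ fun j _ => Measurable.mul (by fun_prop) ?_)
  exact (K.measurable_coe (measurable_prodMk_left hs)).comp (measurable_pi_apply j)

lemma bddMeas_of_parents {h : ℕ → ℕ → ℝ} (hh : ∃ B, ∀ k l, |h k l| ≤ B) :
    BddMeas fun q : (ℕ × X) × (ℕ × X) => h q.1.1 q.2.1 := by
  obtain ⟨B, hB⟩ := hh
  have hm : Measurable fun r : ℕ × ℕ => h r.1 r.2 := measurable_of_countable _
  have hp : Measurable fun q : (ℕ × X) × (ℕ × X) => (q.1.1, q.2.1) := by fun_prop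
  exact ⟨hm.comp hp, B, fun q => hB _ _⟩

lemma rowSq_moveLaw [Nonempty X] (hN : 1 ≤ N) (hg : ∀ x, 0 < g x) (z : ℕ → X) {h : ℕ → ℕ → ℝ}
    (hh : ∃ B, ∀ k l, |h k l| ≤ B) :
    rowSq (moveLaw N g K z) (fun q => h q.1.1 q.2.1) = ∑ k ∈ Finset.range N,
      (g (z k) / ∑ j ∈ Finset.range N, g (z j)) *
        (∑ l ∈ Finset.range N, (g (z l) / ∑ j ∈ Finset.range N, g (z j)) * h k l) ^ 2 := by
  have := isProbabilityMeasure_moveLaw (K := K) hN hg z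
  have hb := bddMeas_of_parents (X := X) hh
  rw [rowSq, integral_moveLaw hN hg z hb.integral_right.sq]
  refine Finset.sum_congr rfl fun k _ => ?_
  have hk : ∫ y, h k y.1 ∂(moveLaw N g K z) =
      ∑ l ∈ Finset.range N, (g (z l) / ∑ j ∈ Finset.range N, g (z j)) * h k l := by
    rw [integral_moveLaw hN hg z
      (hb.comp (g := fun y => ((k, Classical.arbitrary X), y)) (by fun_prop))]
    simp
  simp [hk]

lemma integral_prod_moveLaw (hN : 1 ≤ N) (hg : ∀ x, 0 < g x) (z : ℕ → X)
    {f : (ℕ × X) × (ℕ × X) → ℝ} (hf : BddMeas f) :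
    ∫ q, f q ∂((moveLaw N g K z).prod (moveLaw N g K z)) = ∑ k ∈ Finset.range N,
      (g (z k) / ∑ j ∈ Finset.range N, g (z j)) * ∑ l ∈ Finset.range N,
        (g (z l) / ∑ j ∈ Finset.range N, g (z j)) *
          ∫ x, ∫ x', f ((k, x), (l, x')) ∂(K (z l)) ∂(K (z k)) := by
  have := isProbabilityMeasure_moveLaw (K := K) hN hg z
  rw [integral_prod _ (hf.integrable _), integral_moveLaw hN hg z hf.integral_right]
  refine Finset.sum_congr rfl fun k _ => ?_
  congr 1
  have hk : ∀ x, ∫ y, f ((k, x), y) ∂(moveLaw N g K z) = ∑ l ∈ Finset.range N,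
      (g (z l) / ∑ j ∈ Finset.range N, g (z j)) * ∫ x', f ((k, x), (l, x')) ∂(K (z l)) :=
    fun x => integral_moveLaw hN hg z (hf.comp (g := fun y => ((k, x), y)) (by fun_prop))
  simp only [hk]
  have hi : ∀ l, BddMeas fun x => ∫ x', f ((k, x), (l, x')) ∂(K (z l)) := fun l =>
    BddMeas.integral (κ := fun _ => K (z l)) measurable_const
      (f := fun r : X × X => f ((k, r.1), (l, r.2))) (hf.comp (by fun_prop))
  rw [integral_finsetSum _ fun l _ => ((hi l).const_mul _).integrable _]
  simp only [integral_const_mul]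

lemma integral_sq_moveLaw (hN : 1 ≤ N) (hg : ∀ x, 0 < g x) (z : ℕ → X) {h : ℕ → ℕ → ℝ}
    (hh : ∃ B, ∀ k l, |h k l| ≤ B) :
    ∫ q, h q.1.1 q.2.1 ^ 2 ∂((moveLaw N g K z).prod (moveLaw N g K z)) = ∑ k ∈ Finset.range N,
      (g (z k) / ∑ j ∈ Finset.range N, g (z j)) * ∑ l ∈ Finset.range N,
        (g (z l) / ∑ j ∈ Finset.range N, g (z j)) * h k l ^ 2 := by
  rw [integral_prod_moveLaw hN hg z (bddMeas_of_parents (X := X) hh).sq]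
  simp

/-- The operator `ψ ↦ G(x) G(x') ∫ ψ dM_b((x, x'), ·)` for the doubled chain. -/
def pairOp (b : Bool) (g : X → ℝ) (K : Kernel X X) (ψ : X × X → ℝ) (q : X × X) : ℝ :=
  g q.1 * g q.2 * ∫ x, ∫ x', diagIf b ψ (x, x') ∂(K q.2) ∂(K q.1)

lemma integral_parentW_moveLaw (hN : 1 ≤ N) (hg : ∀ x, 0 < g x) (z : ℕ → X) (b : Bool)
    {T : ℕ → ℕ → ℝ} {ψ : X × X → ℝ} (hψ : BddMeas ψ)
    (hh : ∃ B, ∀ k l, |parentW b N (fun k => g (z k)) T k l| ≤ B) :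
    ∫ q, parentW b N (fun k => g (z k)) T q.1.1 q.2.1 * diagIf b ψ (q.1.2, q.2.2)
        ∂((moveLaw N g K z).prod (moveLaw N g K z)) =
      ∑ k ∈ Finset.range N, ∑ l ∈ Finset.range N, T k l * pairOp b g K ψ (z k, z l) := by
  have hS := sum_weight_pos hN hg z
  rw [integral_prod_moveLaw hN hg z ((bddMeas_of_parents hh).mul
    ((diagIf_bddMeas b hψ).comp (by fun_prop)))]
  refine Finset.sum_congr rfl fun k _ => ?_
  simp only [integral_const_mul, pairOp]
  set S := ∑ j ∈ Finset.range N, g (z j) with hSdef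
  cases b
  · rw [Finset.mul_sum]
    refine Finset.sum_congr rfl fun l _ => ?_
    simp only [parentW, Bool.false_eq_true, if_false, ← hSdef]
    field_simp
  · simp only [diagIf, if_true, integral_const, probReal_univ, one_smul, parentW, ← hSdef]
    rw [← Finset.sum_mul, ← Finset.sum_div, ← hSdef, div_self hS.ne', one_mul, Finset.mul_sum,
      Finset.sum_mul, Finset.mul_sum]
    refine Finset.sum_congr rfl fun l _ => ?_
    field_simp

end OneStep

section StepEstimates

/-- Integral of `ψ` against the weighted pairs of particles. -/
def pairSum (N : ℕ) (T : ℕ → ℕ → ℝ) (z : ℕ → X) (ψ : X × X → ℝ) : ℝ :=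
  ∑ i ∈ Finset.range N, ∑ j ∈ Finset.range N, T i j * ψ (z i, z j)

lemma padF_fin {Y : Type*} [Nonempty Y] {m : ℕ} (f : Fin m → Y) (i : Fin m) :
    padF f (i : ℕ) = f i := by
  simp [padF]

lemma rowSq_const_mul {Y : Type*} [MeasurableSpace Y] (ν : Measure Y) (c : ℝ) (h : Y × Y → ℝ) :
    rowSq ν (fun q => c * h q) = c ^ 2 * rowSq ν h := by
  simp only [rowSq, integral_const_mul, mul_pow]

lemma exists_abs_parentW_le (b : Bool) (N : ℕ) {g : ℕ → ℝ} {T : ℕ → ℕ → ℝ}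
    (hT : ∃ B, ∀ k l, |T k l| ≤ B) : ∃ B, ∀ k l, |parentW b N g T k l| ≤ B := by
  obtain ⟨B, hB⟩ := hT
  cases b
  · refine ⟨(∑ j ∈ Finset.range N, g j) ^ 2 * B, fun k l => ?_⟩
    simp only [parentW, Bool.false_eq_true, if_false, abs_mul, abs_sq]
    exact mul_le_mul_of_nonneg_left (hB k l) (sq_nonneg _)
  · refine ⟨|∑ j ∈ Finset.range N, g j| * ∑ l ∈ Finset.range N, B * |g l|, fun k l => ?_⟩
    simp only [parentW, if_true, abs_mul]
    refine mul_le_mul_of_nonneg_left ?_ (abs_nonneg _)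
    refine (Finset.abs_sum_le_sum_abs _ _).trans (Finset.sum_le_sum fun j _ => ?_)
    rw [abs_mul]
    exact mul_le_mul_of_nonneg_right (hB k j) (abs_nonneg _)

section Sample

variable [Nonempty X] {b : Bool} {m : ℕ} {H : ℕ → ℕ → ℝ}

omit [MeasurableSpace X] in
lemma pairSum_stepW (hm : 2 ≤ m) (hb : b = true → ∀ i j, H i j = H i i) (ψ : X × X → ℝ)
    (y : Fin m → ℕ × X) :
    pairSum m (stepW b m fun i j => H (padF (fun i => (y i).1) i) (padF (fun i => (y i).1) j))
        (padF fun i => (y i).2) ψ =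
      ((m : ℝ) * ((m : ℝ) - 1))⁻¹ * ∑ p ∈ (Finset.univ : Finset (Fin m)).offDiag,
        H (y p.1).1 (y p.2).1 * diagIf b ψ ((y p.1).2, (y p.2).2) := by
  rw [pairSum, sum_sum_stepW_mul
    (h := fun i j => H (padF (fun i => (y i).1) i) (padF (fun i => (y i).1) j)) hm
    (fun h i j => (hb h _ _).trans (hb h _ _).symm)
    (fun i j => ψ (padF (fun i => (y i).2) i, padF (fun i => (y i).2) j))]
  simp only [padF_fin, diagIf]

variable {ν : Measure (ℕ × X)} [IsProbabilityMeasure ν]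

omit [Nonempty X] in
lemma integral_margSq_stepW_le (hm : 2 ≤ m) (hb : b = true → ∀ i j, H i j = H i i)
    (hH : ∃ B, ∀ k l, |H k l| ≤ B) :
    ∫ y, margSq m (stepW b m fun i j =>
        H (padF (fun i => (y i).1) i) (padF (fun i => (y i).1) j))
          ∂(Measure.pi fun _ : Fin m => ν) ≤
      2 * (rowSq ν (fun q => H q.1.1 q.2.1) + rowSq ν (fun q => H q.2.1 q.1.1)) +
        2 * (∫ q, H q.1.1 q.2.1 ^ 2 ∂(ν.prod ν)) / (m - 1) := by
  have hm' : (2 : ℝ) ≤ m := by exact_mod_cast hm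
  have hm1 : (m : ℝ) - 1 ≠ 0 := by linarith
  have hm0 : (m : ℝ) ≠ 0 := by linarith
  have hbm := bddMeas_of_parents (X := X) hH
  have hb' : ∀ (u : ℕ → ℕ), b = true → ∀ i j, H (u i) (u j) = H (u i) (u i) :=
    fun u h i j => (hb h _ _).trans (hb h _ _).symm
  let h' : (ℕ × X) × (ℕ × X) → ℝ := fun q => if b then H q.1.1 q.2.1 else H q.2.1 q.1.1
  have hbm' : BddMeas h' := by
    dsimp only [h']
    cases b
    · simpa using hbm.swap
    · simpa using hbm
  have hA := rowSq_nonneg (ν := ν) (fun q => H q.1.1 q.2.1)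
  have hB := rowSq_nonneg (ν := ν) (fun q => H q.2.1 q.1.1)
  have hrow : rowSq ν h' ≤ rowSq ν (fun q => H q.1.1 q.2.1) + rowSq ν (fun q => H q.2.1 q.1.1) := by
    dsimp only [h']
    cases b
    · simpa using hA
    · simpa using hB
  have hsq : ∫ q, h' q ^ 2 ∂(ν.prod ν) = ∫ q, H q.1.1 q.2.1 ^ 2 ∂(ν.prod ν) := by
    dsimp only [h']
    cases b
    · simpa using integral_sq_swap (ν := ν) (f := fun q => H q.1.1 q.2.1)
    · simp
  have hi : ∀ {f : (ℕ × X) × (ℕ × X) → ℝ}, BddMeas f → ∀ i : Fin m,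
      Integrable (fun y : Fin m → ℕ × X => (∑ j ∈ Finset.univ.erase i, f (y i, y j)) ^ 2)
        (Measure.pi fun _ : Fin m => ν) := fun hf i =>
    (BddMeas.sq (BddMeas.sum _ fun j _ => hf.comp (by fun_prop))).integrable _
  have heq : ∀ y : Fin m → ℕ × X, margSq m (stepW b m fun i j =>
        H (padF (fun i => (y i).1) i) (padF (fun i => (y i).1) j)) =
      m * ((m * (m - 1) : ℝ)⁻¹) ^ 2 * ∑ i,
        (∑ j ∈ Finset.univ.erase i, H (y i).1 (y j).1) ^ 2 +
      m * ((m * (m - 1) : ℝ)⁻¹) ^ 2 * ∑ i, (∑ j ∈ Finset.univ.erase i, h' (y i, y j)) ^ 2 :=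
    fun y => by
      rw [margSq, Finset.sum_range, Finset.sum_range]
      simp only [sum_stepW_row hm (hb' _), sum_stepW_col hm (hb' _), padF_fin, mul_pow,
        ← Finset.mul_sum, mul_assoc, h']
  have hi1 := fun i => hi hbm i
  have hi2 := fun i => hi hbm' i
  simp only [heq]
  rw [integral_add ((integrable_finsetSum _ fun i _ => hi1 i).const_mul _)
      ((integrable_finsetSum _ fun i _ => hi2 i).const_mul _), integral_const_mul,
    integral_const_mul, integral_finsetSum _ fun i _ => hi1 i,
    integral_finsetSum _ fun i _ => hi2 i]
  have hb1 := Finset.sum_le_sum fun i (_ : i ∈ (Finset.univ : Finset (Fin m))) =>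
    integral_sq_sum_erase_le (ν := ν) hbm i
  have hb2 := Finset.sum_le_sum fun i (_ : i ∈ (Finset.univ : Finset (Fin m))) =>
    integral_sq_sum_erase_le (ν := ν) hbm' i
  rw [Finset.sum_const, Finset.card_univ, Fintype.card_fin, nsmul_eq_mul] at hb1 hb2
  rw [hsq] at hb2
  have hc : (0 : ℝ) ≤ m * ((m * (m - 1) : ℝ)⁻¹) ^ 2 := by positivity
  refine (add_le_add (mul_le_mul_of_nonneg_left hb1 hc)
    (mul_le_mul_of_nonneg_left hb2 hc)).trans ?_
  have e : ∀ A C : ℝ, m * ((m * (m - 1) : ℝ)⁻¹) ^ 2 * (m * ((m - 1) ^ 2 * A + (m - 1) * C)) =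
      A + C / (m - 1) := fun A C => by field_simp
  rw [e, e, mul_div_assoc]
  linarith

lemma integral_sq_pairSum_stepW_le (hm : 2 ≤ m) (hb : b = true → ∀ i j, H i j = H i i)
    (hH : ∃ B, ∀ k l, |H k l| ≤ B) (hH0 : ∀ k l, 0 ≤ H k l) {ψ : X × X → ℝ} (hψ : BddMeas ψ)
    {C : ℝ} (hC : ∀ q, |ψ q| ≤ C) (a : ℝ) :
    ∫ y, (pairSum m (stepW b m fun i j =>
        H (padF (fun i => (y i).1) i) (padF (fun i => (y i).1) j))
          (padF fun i => (y i).2) ψ - a) ^ 2 ∂(Measure.pi fun _ : Fin m => ν) ≤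
      ((∫ q, H q.1.1 q.2.1 * diagIf b ψ (q.1.2, q.2.2) ∂(ν.prod ν)) - a) ^ 2 +
        C ^ 2 / m * (4 * (rowSq ν (fun q => H q.1.1 q.2.1) + rowSq ν (fun q => H q.2.1 q.1.1)) +
          2 * (∫ q, H q.1.1 q.2.1 ^ 2 ∂(ν.prod ν)) / (m - 1)) := by
  have hm' : (2 : ℝ) ≤ m := by exact_mod_cast hm
  have hm1 : (m : ℝ) - 1 ≠ 0 := by linarith
  have hm0 : (m : ℝ) ≠ 0 := by linarith
  have hbm := bddMeas_of_parents (X := X) hH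
  let f : (ℕ × X) × (ℕ × X) → ℝ := fun q => H q.1.1 q.2.1 * diagIf b ψ (q.1.2, q.2.2)
  let h : (ℕ × X) × (ℕ × X) → ℝ := fun q => C * H q.1.1 q.2.1
  have hf : BddMeas f := hbm.mul ((diagIf_bddMeas b hψ).comp (by fun_prop))
  have hh : BddMeas h := hbm.const_mul C
  have hfh : ∀ q, |f q| ≤ h q := fun q => by
    simp only [f, h, abs_mul, abs_of_nonneg (hH0 _ _)]
    rw [mul_comm]
    exact mul_le_mul_of_nonneg_right (abs_diagIf_le b hC _) (hH0 _ _)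
  simp only [pairSum_stepW hm hb]
  change ∫ y, ((m * (m - 1) : ℝ)⁻¹ * ∑ p ∈ Finset.univ.offDiag, f (y p.1, y p.2) - a) ^ 2
    ∂(Measure.pi fun _ : Fin m => ν) ≤ ((∫ q, f q ∂(ν.prod ν)) - a) ^ 2 + _
  have hsum : BddMeas fun y : Fin m → ℕ × X => ∑ p ∈ Finset.univ.offDiag, f (y p.1, y p.2) :=
    BddMeas.sum _ fun p _ => hf.comp (by fun_prop)
  have hexp : ∀ y : Fin m → ℕ × X,
      ((m * (m - 1) : ℝ)⁻¹ * ∑ p ∈ Finset.univ.offDiag, f (y p.1, y p.2) - a) ^ 2 =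
      ((m * (m - 1) : ℝ)⁻¹) ^ 2 * (∑ p ∈ Finset.univ.offDiag, f (y p.1, y p.2)) ^ 2 -
        (2 * a * (m * (m - 1) : ℝ)⁻¹ * ∑ p ∈ Finset.univ.offDiag, f (y p.1, y p.2)) + a ^ 2 :=
    fun y => by ring
  simp only [hexp]
  rw [integral_add (((hsum.sq.const_mul _).sub (hsum.const_mul _)).integrable _)
      (integrable_const _), integral_sub ((hsum.sq.const_mul _).integrable _)
      ((hsum.const_mul _).integrable _), integral_const_mul, integral_const_mul,
    integral_sum_offDiag hf, integral_const, probReal_univ, one_smul]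
  have key := integral_sq_sum_offDiag_le (ν := ν) (m := m) hf hh hfh
  have e1 : rowSq ν h = C ^ 2 * rowSq ν (fun q => H q.1.1 q.2.1) := rowSq_const_mul _ _ _
  have e2 : rowSq ν (fun q => h q.swap) = C ^ 2 * rowSq ν (fun q => H q.2.1 q.1.1) :=
    rowSq_const_mul ν C fun q : (ℕ × X) × (ℕ × X) => H q.2.1 q.1.1
  have e3 : ∫ q, h q ^ 2 ∂(ν.prod ν) = C ^ 2 * ∫ q, H q.1.1 q.2.1 ^ 2 ∂(ν.prod ν) := by
    simp only [h, mul_pow, integral_const_mul]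
  rw [e1, e2, e3] at key
  have key2 := mul_le_mul_of_nonneg_left key (sq_nonneg ((m * (m - 1) : ℝ)⁻¹))
  refine (add_le_add_left (sub_le_sub_right key2 _) _).trans (le_of_eq ?_)
  field_simp
  ring

end Sample

variable [Nonempty X] {N m : ℕ} {g : X → ℝ} {K : Kernel X X} [IsMarkovKernel K] {b : Bool}
  {T : ℕ → ℕ → ℝ} {Cg : ℝ}

lemma rowSq_parentW_le (hN : 1 ≤ N) (hg : ∀ x, 0 < g x) (hgC : ∀ x, g x ≤ Cg)
    (hT : ∀ k l, 0 ≤ T k l) (hTB : ∃ B, ∀ k l, |T k l| ≤ B) (z : ℕ → X) :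
    rowSq (moveLaw N g K z) (fun q => parentW b N (fun k => g (z k)) T q.1.1 q.2.1) +
      rowSq (moveLaw N g K z) (fun q => parentW b N (fun k => g (z k)) T q.2.1 q.1.1) ≤
      2 * (Cg ^ 4 * margSq N T) := by
  have hS := sum_weight_pos hN hg z
  have hB := exists_abs_parentW_le b N (g := fun k => g (z k)) hTB
  rw [rowSq_moveLaw hN hg z hB, rowSq_moveLaw hN hg z
    (h := fun k l => parentW b N (fun k => g (z k)) T l k) (hB.imp fun _ h k l => h l k), two_mul]
  refine add_le_add ((sum_weight_row_sq_le (fun k => (hg (z k)).le) (fun k => hgC (z k)) hT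
    hS).trans (mul_le_mul_of_nonneg_left row_le_margSq (by positivity)))
    (sum_weight_col_sq_le (fun k => (hg (z k)).le) (fun k => hgC (z k)) hT hS)

omit [Nonempty X] in
lemma integral_sq_parentW_le (hN : 1 ≤ N) (hg : ∀ x, 0 < g x) (hgC : ∀ x, g x ≤ Cg)
    (hT : ∀ k l, 0 ≤ T k l) (hTB : ∃ B, ∀ k l, |T k l| ≤ B) (z : ℕ → X) :
    ∫ q, parentW b N (fun k => g (z k)) T q.1.1 q.2.1 ^ 2
      ∂((moveLaw N g K z).prod (moveLaw N g K z)) ≤ N * (Cg ^ 4 * margSq N T) := by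
  rw [integral_sq_moveLaw hN hg z (exists_abs_parentW_le b N (g := fun k => g (z k)) hTB)]
  exact sum_weight_sum_sq_le (fun k => (hg (z k)).le) (fun k => hgC (z k)) hT
    (sum_weight_pos hN hg z)

lemma integral_margSq_step_le (hN : 1 ≤ N) (hm : 2 ≤ m) (hg : ∀ x, 0 < g x)
    (hgC : ∀ x, g x ≤ Cg) (hT : ∀ k l, 0 ≤ T k l) (hTB : ∃ B, ∀ k l, |T k l| ≤ B) (z : ℕ → X)
    {ρ : ℝ} (hρ : (N : ℝ) / (m - 1) ≤ ρ) :
    ∫ y, margSq m (stepW b m fun i j => parentW b N (fun k => g (z k)) T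
        (padF (fun i => (y i).1) i) (padF (fun i => (y i).1) j))
          ∂(Measure.pi fun _ : Fin m => moveLaw N g K z) ≤
      Cg ^ 4 * (4 + 2 * ρ) * margSq N T := by
  have := isProbabilityMeasure_moveLaw (K := K) hN hg z
  have hm' : (2 : ℝ) ≤ m := by exact_mod_cast hm
  refine (integral_margSq_stepW_le (ν := moveLaw N g K z)
    (H := parentW b N (fun k => g (z k)) T) hm (fun hb i j => parentW_true hb _ _ _)
    (exists_abs_parentW_le b N hTB)).trans ?_
  have h1 := rowSq_parentW_le (b := b) (K := K) hN hg hgC hT hTB z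
  have h2 := integral_sq_parentW_le (b := b) (K := K) hN hg hgC hT hTB z
  have h3 := div_le_div_of_nonneg_right h2 (show (0 : ℝ) ≤ m - 1 by linarith)
  have h4 : 0 ≤ Cg ^ 4 * margSq N T := mul_nonneg (by positivity) (margSq_nonneg _ _)
  have h5 := mul_le_mul_of_nonneg_right hρ h4
  rw [div_mul_eq_mul_div] at h5
  rw [mul_div_assoc]
  linarith

lemma integral_sq_pairSum_step_le (hN : 1 ≤ N) (hm : 2 ≤ m) (hg : ∀ x, 0 < g x)
    (hgC : ∀ x, g x ≤ Cg) (hT : ∀ k l, 0 ≤ T k l) (hTB : ∃ B, ∀ k l, |T k l| ≤ B) (z : ℕ → X)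
    {ρ : ℝ} (hρ : (N : ℝ) / (m - 1) ≤ ρ) {ψ : X × X → ℝ} (hψ : BddMeas ψ) {C : ℝ}
    (hC : ∀ q, |ψ q| ≤ C) (a : ℝ) :
    ∫ y, (pairSum m (stepW b m fun i j => parentW b N (fun k => g (z k)) T
        (padF (fun i => (y i).1) i) (padF (fun i => (y i).1) j)) (padF fun i => (y i).2) ψ - a) ^ 2
          ∂(Measure.pi fun _ : Fin m => moveLaw N g K z) ≤
      (pairSum N T z (pairOp b g K ψ) - a) ^ 2 +
        C ^ 2 * (Cg ^ 4 * (8 + 2 * ρ)) / m * margSq N T := by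
  have := isProbabilityMeasure_moveLaw (K := K) hN hg z
  have hm' : (2 : ℝ) ≤ m := by exact_mod_cast hm
  have hB := exists_abs_parentW_le b N (g := fun k => g (z k)) hTB
  refine (integral_sq_pairSum_stepW_le (ν := moveLaw N g K z)
    (H := parentW b N (fun k => g (z k)) T) hm (fun hb i j => parentW_true hb _ _ _) hB
    (parentW_nonneg (fun k => (hg (z k)).le) hT) hψ hC a).trans ?_
  rw [integral_parentW_moveLaw hN hg z b hψ hB]
  refine add_le_add_right ?_ _
  have h1 := rowSq_parentW_le (b := b) (K := K) hN hg hgC hT hTB z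
  have h2 := integral_sq_parentW_le (b := b) (K := K) hN hg hgC hT hTB z
  have h3 := div_le_div_of_nonneg_right h2 (show (0 : ℝ) ≤ m - 1 by linarith)
  have h4 : 0 ≤ Cg ^ 4 * margSq N T := mul_nonneg (by positivity) (margSq_nonneg _ _)
  have h5 := mul_le_mul_of_nonneg_right hρ h4
  rw [div_mul_eq_mul_div] at h5
  rw [mul_div_assoc 2]
  refine (mul_le_mul_of_nonneg_left (c := Cg ^ 4 * margSq N T * (8 + 2 * ρ)) ?_
    (by positivity)).trans (le_of_eq (by ring))
  linarith

end StepEstimates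

section ParticleLaw

variable [Nonempty X]

/-- The particle system extended by a new generation of ancestor indices and positions. -/
def stepMap {m : ℕ} (p : ℕ) (r : ((ℕ → ℕ → X) × (ℕ → ℕ → ℕ)) × (Fin m → ℕ × X)) :
    (ℕ → ℕ → X) × (ℕ → ℕ → ℕ) :=
  (Function.update r.1.1 (p + 1) (padF fun i => (r.2 i).2),
    Function.update r.1.2 p (padF fun i => (r.2 i).1))

lemma measurable_padF {Y : Type*} [MeasurableSpace Y] [Nonempty Y] {m : ℕ} :
    Measurable (padF : (Fin m → Y) → ℕ → Y) := by
  refine measurable_pi_lambda _ fun i => ?_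
  by_cases h : i < m
  · simpa only [padF, h, dite_true] using measurable_pi_apply _
  · simpa only [padF, h, dite_false] using measurable_const

lemma measurable_stepMap {m : ℕ} (p : ℕ) : Measurable (stepMap (X := X) (m := m) p) := by
  have h1 : Measurable fun r : ((ℕ → ℕ → X) × (ℕ → ℕ → ℕ)) × (Fin m → ℕ × X) =>
      padF fun i => (r.2 i).2 := measurable_padF.comp (by fun_prop)
  have h2 : Measurable fun r : ((ℕ → ℕ → X) × (ℕ → ℕ → ℕ)) × (Fin m → ℕ × X) =>
      padF fun i => (r.2 i).1 := measurable_padF.comp (by fun_prop)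
  exact (measurable_update'.comp (measurable_fst.fst.prodMk h1)).prodMk
    (measurable_update'.comp (measurable_fst.snd.prodMk h2))

variable {M0 : Measure X} [IsProbabilityMeasure M0] {M : ℕ → Kernel X X}
  [∀ p, IsMarkovKernel (M p)] {G : ℕ → X → ℝ} {Np : ℕ → ℕ} {b : ℕ → Bool}

omit [IsProbabilityMeasure M0] [∀ p, IsMarkovKernel (M p)] in
lemma pfLaw_succ (k : ℕ) :
    pfLaw M0 M G Np (k + 1) = (pfLaw M0 M G Np k).bind fun ω =>
      (Measure.pi fun _ : Fin (Np (k + 1)) => moveLaw (Np k) (G k) (M (k + 1)) (ω.1 k)).map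
        fun y => stepMap k (ω, y) := by
  rw [pfLaw]
  congr 1
  funext ω
  rw [pfStep, Measure.map_map]
  · rfl
  · exact ((measurable_update _).comp measurable_snd).prodMk
      ((measurable_update _).comp measurable_fst)
  · exact (measurable_padF.comp (by fun_prop)).prodMk (measurable_padF.comp (by fun_prop))

omit [Nonempty X] in
lemma measurable_pi_moveLaw {k : ℕ} (hN : 1 ≤ Np k) (hGm : Measurable (G k))
    (hG : ∀ x, 0 < G k x) :
    Measurable fun ω : (ℕ → ℕ → X) × (ℕ → ℕ → ℕ) =>
      Measure.pi fun _ : Fin (Np (k + 1)) => moveLaw (Np k) (G k) (M (k + 1)) (ω.1 k) := by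
  have := fun ω : (ℕ → ℕ → X) × (ℕ → ℕ → ℕ) =>
    isProbabilityMeasure_moveLaw (K := M (k + 1)) hN hG (ω.1 k)
  exact measurable_measure_pi (κ := fun ω : (ℕ → ℕ → X) × (ℕ → ℕ → ℕ) =>
    moveLaw (Np k) (G k) (M (k + 1)) (ω.1 k)) ((measurable_moveLaw hGm).comp (by fun_prop))

lemma isProbabilityMeasure_pfLaw {k : ℕ} (hN : ∀ p < k, 1 ≤ Np p)
    (hGm : ∀ p < k, Measurable (G p)) (hG : ∀ p < k, ∀ x, 0 < G p x) :
    IsProbabilityMeasure (pfLaw M0 M G Np k) := by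
  induction k with
  | zero =>
    refine Measure.isProbabilityMeasure_map (Measurable.aemeasurable ?_)
    refine Measurable.prodMk (measurable_pi_lambda _ fun p => ?_) measurable_const
    split_ifs
    exacts [measurable_padF, measurable_const]
  | succ k ih =>
    have := ih (fun p hp => hN p (by lia)) (fun p hp => hGm p (by lia)) fun p hp => hG p (by lia)
    have h1 := fun ω : (ℕ → ℕ → X) × (ℕ → ℕ → ℕ) =>
      isProbabilityMeasure_moveLaw (K := M (k + 1)) (hN k (by lia)) (hG k (by lia)) (ω.1 k)
    have h2 : ∀ ω, IsProbabilityMeasure ((Measure.pi fun _ : Fin (Np (k + 1)) =>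
        moveLaw (Np k) (G k) (M (k + 1)) (ω.1 k)).map fun y => stepMap k (ω, y)) := fun ω =>
      Measure.isProbabilityMeasure_map
        ((measurable_stepMap k).comp (by fun_prop)).aemeasurable
    rw [pfLaw_succ]
    exact isProbabilityMeasure_bind_of_forall (measurable_map_of_joint
      (measurable_pi_moveLaw (hN k (by lia)) (hGm k (by lia)) (hG k (by lia)))
      (measurable_stepMap k))

lemma integral_pfLaw_succ {k : ℕ} (hN : ∀ p ≤ k, 1 ≤ Np p)
    (hGm : ∀ p ≤ k, Measurable (G p)) (hG : ∀ p ≤ k, ∀ x, 0 < G p x)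
    {F : (ℕ → ℕ → X) × (ℕ → ℕ → ℕ) → ℝ} (hF : BddMeas F) :
    ∫ ω, F ω ∂(pfLaw M0 M G Np (k + 1)) =
      ∫ ω, ∫ y, F (stepMap k (ω, y)) ∂(Measure.pi fun _ : Fin (Np (k + 1)) =>
        moveLaw (Np k) (G k) (M (k + 1)) (ω.1 k)) ∂(pfLaw M0 M G Np k) := by
  have := isProbabilityMeasure_pfLaw (M0 := M0) (M := M) (k := k) (fun p hp => hN p hp.le)
    (fun p hp => hGm p hp.le) fun p hp => hG p hp.le
  have h1 := fun ω : (ℕ → ℕ → X) × (ℕ → ℕ → ℕ) =>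
    isProbabilityMeasure_moveLaw (K := M (k + 1)) (hN k le_rfl) (hG k le_rfl) (ω.1 k)
  have h2 : ∀ ω, IsProbabilityMeasure ((Measure.pi fun _ : Fin (Np (k + 1)) =>
      moveLaw (Np k) (G k) (M (k + 1)) (ω.1 k)).map fun y => stepMap k (ω, y)) := fun ω =>
    Measure.isProbabilityMeasure_map ((measurable_stepMap k).comp (by fun_prop)).aemeasurable
  rw [pfLaw_succ, integral_bind_of_bddMeas (measurable_map_of_joint
      (measurable_pi_moveLaw (hN k le_rfl) (hGm k le_rfl) (hG k le_rfl))
      (measurable_stepMap k)) hF]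
  refine integral_congr_ae (ae_of_all _ fun ω => ?_)
  exact integral_map ((measurable_stepMap k).comp (by fun_prop)).aemeasurable
    hF.1.aestronglyMeasurable

omit [MeasurableSpace X] [Nonempty X] in
lemma pairW_zero (ω : (ℕ → ℕ → X) × (ℕ → ℕ → ℕ)) :
    pairW b G Np 0 ω = stepW (b 0) (Np 0) fun _ _ => 1 := rfl

omit [MeasurableSpace X] [Nonempty X] in
lemma pairW_succ (p : ℕ) (ω : (ℕ → ℕ → X) × (ℕ → ℕ → ℕ)) :
    pairW b G Np (p + 1) ω = stepW (b (p + 1)) (Np (p + 1)) fun i j =>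
      parentW (b (p + 1)) (Np p) (fun k => G p (ω.1 p k)) (pairW b G Np p ω)
        (ω.2 p i) (ω.2 p j) := rfl

omit [MeasurableSpace X] [Nonempty X] in
lemma pairW_congr {ω ω' : (ℕ → ℕ → X) × (ℕ → ℕ → ℕ)} {p : ℕ} (h1 : ∀ q < p, ω.1 q = ω'.1 q)
    (h2 : ∀ q < p, ω.2 q = ω'.2 q) : pairW b G Np p ω = pairW b G Np p ω' := by
  induction p with
  | zero => rfl
  | succ p ih =>
    simp only [pairW_succ, h1 p (by lia), h2 p (by lia),
      ih (fun q hq => h1 q (by lia)) fun q hq => h2 q (by lia)]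

omit [MeasurableSpace X] in
lemma pairW_stepMap {m : ℕ} (p : ℕ) (ω : (ℕ → ℕ → X) × (ℕ → ℕ → ℕ)) (y : Fin m → ℕ × X) :
    pairW b G Np (p + 1) (stepMap p (ω, y)) = stepW (b (p + 1)) (Np (p + 1)) fun i j =>
      parentW (b (p + 1)) (Np p) (fun k => G p (ω.1 p k)) (pairW b G Np p ω)
        (padF (fun i => (y i).1) i) (padF (fun i => (y i).1) j) := by
  have h : pairW b G Np p (stepMap p (ω, y)) = pairW b G Np p ω := by
    refine pairW_congr (fun q hq => ?_) fun q hq => ?_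
    · exact Function.update_of_ne (by lia) _ _
    · exact Function.update_of_ne (by lia) _ _
  rw [pairW_succ, h]
  simp [stepMap]

omit [MeasurableSpace X] [Nonempty X] in
lemma pairW_nonneg {p : ℕ} (hN : ∀ q ≤ p, 1 ≤ Np q) (hG : ∀ q < p, ∀ x, 0 < G q x)
    (ω : (ℕ → ℕ → X) × (ℕ → ℕ → ℕ)) (i j : ℕ) : 0 ≤ pairW b G Np p ω i j := by
  induction p generalizing i j with
  | zero => exact stepW_nonneg (hN 0 le_rfl) (fun _ _ => zero_le_one) i j
  | succ p ih =>
    rw [pairW_succ]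
    exact stepW_nonneg (hN _ le_rfl) (fun i j => parentW_nonneg (fun k => (hG p (by lia) _).le)
      (ih (fun q hq => hN q (by lia)) fun q hq => hG q (by lia)) _ _) i j

lemma abs_stepW_le {b : Bool} {N : ℕ} {h : ℕ → ℕ → ℝ} {B : ℝ} (hB : ∀ i j, |h i j| ≤ B)
    (i j : ℕ) :
    |stepW b N h i j| ≤ |if b then (N : ℝ)⁻¹ else ((N : ℝ) * ((N : ℝ) - 1))⁻¹| * B := by
  have hB0 : 0 ≤ B := (abs_nonneg _).trans (hB 0 0)
  rw [stepW]
  split_ifs with h1 h2 h2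
  · rw [abs_mul]
    exact mul_le_mul_of_nonneg_left (hB _ _) (abs_nonneg _)
  · rw [abs_mul]
    exact mul_le_mul_of_nonneg_left (hB _ _) (abs_nonneg _)
  all_goals
    rw [abs_zero]
    positivity

lemma abs_parentW_le {b : Bool} {N : ℕ} {g : ℕ → ℝ} {T : ℕ → ℕ → ℝ} {B C : ℝ}
    (hg : ∀ k, |g k| ≤ C) (hT : ∀ k l, |T k l| ≤ B) (k l : ℕ) :
    |parentW b N g T k l| ≤ (N * C) ^ 2 * B := by
  have hB0 : 0 ≤ B := (abs_nonneg _).trans (hT 0 0)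
  have hC0 : 0 ≤ C := (abs_nonneg _).trans (hg 0)
  have hS : |∑ j ∈ Finset.range N, g j| ≤ N * C :=
    (Finset.abs_sum_le_sum_abs _ _).trans ((Finset.sum_le_sum fun j _ => hg j).trans (by simp))
  cases b
  · simp only [parentW, Bool.false_eq_true, if_false, abs_mul, abs_pow]
    exact mul_le_mul (pow_le_pow_left₀ (abs_nonneg _) hS 2) (hT k l) (abs_nonneg _) (by positivity)
  · simp only [parentW, if_true, abs_mul]
    have h : |∑ l ∈ Finset.range N, T k l * g l| ≤ N * (B * C) := by
      refine (Finset.abs_sum_le_sum_abs _ _).trans ((Finset.sum_le_sum fun j _ =>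
        (?_ : _ ≤ B * C)).trans (by simp))
      rw [abs_mul]
      exact mul_le_mul (hT k j) (hg j) (abs_nonneg _) hB0
    refine (mul_le_mul hS h (abs_nonneg _) (by positivity)).trans (le_of_eq (by ring))

omit [MeasurableSpace X] [Nonempty X] in
lemma exists_abs_pairW_le {p : ℕ} (hG : ∀ q < p, ∃ C, ∀ x, |G q x| ≤ C) :
    ∃ B, ∀ (ω : (ℕ → ℕ → X) × (ℕ → ℕ → ℕ)) i j, |pairW b G Np p ω i j| ≤ B := by
  induction p with
  | zero =>
    simp only [pairW_zero]
    exact ⟨_, fun ω i j => abs_stepW_le (B := 1) (fun _ _ => abs_one.le) i j⟩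
  | succ p ih =>
    obtain ⟨B, hB⟩ := ih fun q hq => hG q (by lia)
    obtain ⟨C, hC⟩ := hG p (by lia)
    simp only [pairW_succ]
    exact ⟨_, fun ω i j => abs_stepW_le
      (fun i j => abs_parentW_le (fun k => hC _) (hB ω) _ _) i j⟩

lemma measurable_eval_index {α : Type*} [MeasurableSpace α] {F : ℕ → ℕ → α → ℝ}
    (hF : ∀ k l, Measurable (F k l)) {u v : α → ℕ} (hu : Measurable u) (hv : Measurable v) :
    Measurable fun x => F (u x) (v x) x := by
  have h : Measurable fun r : (ℕ × ℕ) × α => F r.1.1 r.1.2 r.2 :=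
    measurable_from_prod_countable_right fun r => hF r.1 r.2
  exact h.comp ((hu.prodMk hv).prodMk measurable_id)

omit [Nonempty X] in
lemma measurable_pairW {p : ℕ} (hG : ∀ q < p, Measurable (G q)) (i j : ℕ) :
    Measurable fun ω : (ℕ → ℕ → X) × (ℕ → ℕ → ℕ) => pairW b G Np p ω i j := by
  induction p generalizing i j with
  | zero => exact measurable_const
  | succ p ih =>
    have hT := ih fun q hq => hG q (by lia)
    have hg := hG p (by lia)
    have hP : ∀ k l, Measurable fun ω : (ℕ → ℕ → X) × (ℕ → ℕ → ℕ) =>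
        parentW (b (p + 1)) (Np p) (fun k => G p (ω.1 p k)) (pairW b G Np p ω) k l := by
      intro k l
      have hS : Measurable fun ω : (ℕ → ℕ → X) × (ℕ → ℕ → ℕ) =>
          ∑ j ∈ Finset.range (Np p), G p (ω.1 p j) :=
        Finset.measurable_sum _ fun j _ => by fun_prop
      unfold parentW
      split_ifs
      · exact hS.mul (Finset.measurable_sum _ fun j _ => (hT k j).mul (by fun_prop))
      · exact (hS.pow_const 2).mul (hT k l)
    simp only [pairW_succ, stepW]
    by_cases hij : i < Np (p + 1) ∧ j < Np (p + 1) ∧ (i = j ↔ b (p + 1) = true)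
    · simp only [hij]
      exact (measurable_eval_index hP (by fun_prop) (by fun_prop)).const_mul _
    · simp only [hij, if_false]
      exact measurable_const

omit [Nonempty X] in
lemma bddMeas_pairW {p : ℕ} (hGm : ∀ q < p, Measurable (G q))
    (hG : ∀ q < p, ∃ C, ∀ x, |G q x| ≤ C) (i j : ℕ) :
    BddMeas fun ω : (ℕ → ℕ → X) × (ℕ → ℕ → ℕ) => pairW b G Np p ω i j :=
  ⟨measurable_pairW hGm i j, (exists_abs_pairW_le hG).imp fun _ h ω => h ω i j⟩

omit [Nonempty X] in
lemma bddMeas_margSq_pairW {p : ℕ} (hGm : ∀ q < p, Measurable (G q))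
    (hG : ∀ q < p, ∃ C, ∀ x, |G q x| ≤ C) (m : ℕ) :
    BddMeas fun ω : (ℕ → ℕ → X) × (ℕ → ℕ → ℕ) => margSq m (pairW b G Np p ω) := by
  have h := bddMeas_pairW (b := b) (Np := Np) hGm hG
  exact (BddMeas.const_mul _ (BddMeas.sum _ fun i _ => (BddMeas.sum _ fun j _ => h i j).sq)).add
    (BddMeas.const_mul _ (BddMeas.sum _ fun j _ => (BddMeas.sum _ fun i _ => h i j).sq))

omit [Nonempty X] in
lemma bddMeas_pairSum_pairW {p : ℕ} (hGm : ∀ q < p, Measurable (G q))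
    (hG : ∀ q < p, ∃ C, ∀ x, |G q x| ≤ C) (m : ℕ) {ψ : X × X → ℝ} (hψ : BddMeas ψ) :
    BddMeas fun ω : (ℕ → ℕ → X) × (ℕ → ℕ → ℕ) =>
      pairSum m (pairW b G Np p ω) (ω.1 p) ψ :=
  BddMeas.sum _ fun i _ => BddMeas.sum _ fun j _ => (bddMeas_pairW hGm hG i j).mul
    (hψ.comp (by fun_prop))

end ParticleLaw

section DoubledChain

section MarkovPath

variable {Y : Type*} [MeasurableSpace Y] {μ : Measure Y} [IsProbabilityMeasure μ]
  {κ : ℕ → Y → Measure Y} [∀ p y, IsProbabilityMeasure (κ p y)]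

lemma isProbabilityMeasure_map_update (ω : ℕ → Y) (k : ℕ) :
    IsProbabilityMeasure ((κ (k + 1) (ω k)).map fun y => Function.update ω (k + 1) y) :=
  Measure.isProbabilityMeasure_map (measurable_update ω).aemeasurable

lemma measurable_map_update (hκ : ∀ p, Measurable (κ p))
    (k : ℕ) :
    Measurable fun ω : ℕ → Y =>
      (κ (k + 1) (ω k)).map fun y => Function.update ω (k + 1) y :=
  measurable_map_of_joint (κ := fun ω : ℕ → Y => κ (k + 1) (ω k))
    ((hκ _).comp (measurable_pi_apply k)) measurable_update'

lemma isProbabilityMeasure_markovPath (hκ : ∀ p, Measurable (κ p)) (k : ℕ) :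
    IsProbabilityMeasure (markovPath μ κ k) := by
  induction k with
  | zero => exact Measure.isProbabilityMeasure_map (by fun_prop)
  | succ k ih =>
    have := fun ω : ℕ → Y => isProbabilityMeasure_map_update (κ := κ) ω k
    exact isProbabilityMeasure_bind_of_forall (measurable_map_update hκ k)

lemma integral_markovPath_succ (hκ : ∀ p, Measurable (κ p)) (k : ℕ) {F : (ℕ → Y) → ℝ}
    (hF : BddMeas F) :
    ∫ ω, F ω ∂(markovPath μ κ (k + 1)) =
      ∫ ω, ∫ y, F (Function.update ω (k + 1) y) ∂(κ (k + 1) (ω k)) ∂(markovPath μ κ k) := by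
  have := isProbabilityMeasure_markovPath (μ := μ) hκ k
  have := fun ω : ℕ → Y => isProbabilityMeasure_map_update (κ := κ) ω k
  rw [markovPath, integral_bind_of_bddMeas (measurable_map_update hκ k) hF]
  exact integral_congr_ae (ae_of_all _ fun ω =>
    integral_map (measurable_update ω).aemeasurable hF.1.aestronglyMeasurable)

end MarkovPath

variable {M0 : Measure X} [IsProbabilityMeasure M0] {M : ℕ → Kernel X X}
  [∀ p, IsMarkovKernel (M p)] {G : ℕ → X → ℝ} {b : ℕ → Bool} {φ : X × X → ℝ}

instance isProbabilityMeasure_pairInit : IsProbabilityMeasure (pairInit M0 b) := by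
  unfold pairInit
  split_ifs
  · exact Measure.isProbabilityMeasure_map (by fun_prop)
  · infer_instance

instance isProbabilityMeasure_pairKer (p : ℕ) (q : X × X) :
    IsProbabilityMeasure (pairKer M b p q) := by
  unfold pairKer
  split_ifs
  · exact Measure.isProbabilityMeasure_map (by fun_prop)
  · infer_instance

lemma measurable_pairKer (p : ℕ) : Measurable (pairKer M b p) := by
  unfold pairKer
  split_ifs
  · exact measurable_map_of_joint (κ := fun q : X × X => M p q.1) (g := fun r => (r.2, r.2))
      ((M p).measurable.comp measurable_fst) (by fun_prop)
  · convert ((M p).comap Prod.fst measurable_fst ×ₖ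
      (M p).comap Prod.snd measurable_snd).measurable using 2 with q
    simp [Kernel.prod_apply]

lemma integral_diagIf_prod {μ : Measure X} [IsProbabilityMeasure μ] (hφ : BddMeas φ) (b : Bool) :
    ∫ q, diagIf b φ q ∂(μ.prod μ) =
      if b then ∫ x, φ (x, x) ∂μ else ∫ q, φ q ∂(μ.prod μ) := by
  rw [integral_prod _ ((diagIf_bddMeas b hφ).integrable _)]
  cases b
  · simp only [diagIf, Bool.false_eq_true, if_false]
    rw [integral_prod _ (hφ.integrable _)]
  · simp [diagIf]

lemma integral_pairInit (hφ : BddMeas φ) :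
    ∫ q, φ q ∂(pairInit M0 b) = ∫ q, diagIf (b 0) φ q ∂(M0.prod M0) := by
  rw [integral_diagIf_prod hφ, pairInit]
  split_ifs
  · exact integral_map (by fun_prop) hφ.1.aestronglyMeasurable
  · rfl

lemma integral_pairKer (hφ : BddMeas φ) (p : ℕ) (q : X × X) :
    ∫ r, φ r ∂(pairKer M b p q) =
      ∫ x, ∫ x', diagIf (b p) φ (x, x') ∂(M p q.2) ∂(M p q.1) := by
  rw [pairKer]
  split_ifs with h
  · rw [integral_map (by fun_prop) hφ.1.aestronglyMeasurable]
    simp [diagIf, h]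
  · rw [integral_prod _ (hφ.integrable _)]
    simp [diagIf, h]

lemma bddMeas_pairOp {g : X → ℝ} (hg : BddMeas g) (hφ : BddMeas φ) (p : ℕ) :
    BddMeas (pairOp (b p) g (M p) φ) := by
  have h : BddMeas fun q => ∫ r, φ r ∂(pairKer M b p q) :=
    BddMeas.integral (measurable_pairKer p) (hφ.comp measurable_snd)
  simp only [integral_pairKer hφ] at h
  exact ((hg.comp measurable_fst).mul (hg.comp measurable_snd)).mul h

omit [∀ p, IsMarkovKernel (M p)] in
lemma muB_zero (hφ : BddMeas φ) :
    muB M0 M G 0 b φ = ∫ q, diagIf (b 0) φ q ∂(M0.prod M0) := by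
  have h : Measurable fun ω : ℕ → X × X => φ (ω 0) := hφ.1.comp (measurable_pi_apply 0)
  simp only [← integral_pairInit hφ, muB, markovPath, Finset.range_zero, Finset.prod_empty, mul_one]
  exact integral_map (by fun_prop) h.aestronglyMeasurable

lemma muB_succ {n : ℕ} (hG : ∀ p ≤ n, BddMeas (G p)) (hφ : BddMeas φ) :
    muB M0 M G (n + 1) b φ = muB M0 M G n b (pairOp (b (n + 1)) (G n) (M (n + 1)) φ) := by
  have hF : BddMeas fun ω : ℕ → X × X =>
      φ (ω (n + 1)) * ∏ p ∈ Finset.range (n + 1), G p (ω p).1 * G p (ω p).2 :=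
    (hφ.comp (measurable_pi_apply _)).mul (BddMeas.prod _ fun p hp =>
      have hp' : p ≤ n := by simpa [Nat.lt_succ_iff] using hp
      ((hG p hp').comp (by fun_prop)).mul ((hG p hp').comp (by fun_prop)))
  rw [muB, integral_markovPath_succ measurable_pairKer n hF, muB]
  refine integral_congr_ae (ae_of_all _ fun ω => ?_)
  have h : ∀ y, ∏ p ∈ Finset.range (n + 1), G p (Function.update ω (n + 1) y p).1 *
      G p (Function.update ω (n + 1) y p).2 =
      ∏ p ∈ Finset.range (n + 1), G p (ω p).1 * G p (ω p).2 := fun y =>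
    Finset.prod_congr rfl fun p hp => by
      rw [Function.update_of_ne (Finset.mem_range.1 hp).ne]
  simp only [h, Function.update_self, integral_mul_const, integral_pairKer hφ,
    Finset.prod_range_succ, pairOp]
  ring

end DoubledChain

section Convergence

lemma npart_ratio_le {c : ℕ → ℝ} {N p q : ℕ} (hN : 1 ≤ N) (hp : 0 < c p) (hq : 0 < c q)
    (h2 : 2 ≤ npart c N q) :
    (npart c N p : ℝ) / (npart c N q - 1) ≤ 2 * (c p + 1) / c q := by
  have hN' : (1 : ℝ) ≤ N := by exact_mod_cast hN
  have h2' : (2 : ℝ) ≤ npart c N q := by exact_mod_cast h2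
  have h3 : (npart c N p : ℝ) ≤ (c p + 1) * N := by
    have := (Nat.ceil_lt_add_one (a := c p * N) (by positivity)).le
    unfold npart
    linarith
  have h4 : c q * N ≤ npart c N q := Nat.le_ceil _
  rw [div_le_div_iff₀ (by linarith) hq]
  calc npart c N p * c q ≤ (c p + 1) * N * c q := by gcongr
    _ = (c p + 1) * (c q * N) := by ring
    _ ≤ (c p + 1) * (2 * (npart c N q - 1)) :=
        mul_le_mul_of_nonneg_left (by linarith) (by linarith)
    _ = _ := by ring

lemma div_npart_le {c : ℕ → ℝ} {N p : ℕ} (hN : 1 ≤ N) (hp : 0 < c p) :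
    (N : ℝ) / npart c N p ≤ 1 / c p := by
  have hN' : (1 : ℝ) ≤ N := by exact_mod_cast hN
  have h4 : c p * N ≤ npart c N p := Nat.le_ceil _
  have h5 : 0 < c p * N := by positivity
  rw [div_le_div_iff₀ (by linarith) hp]
  linarith

variable [Nonempty X] {M0 : Measure X} [IsProbabilityMeasure M0] {M : ℕ → Kernel X X}
  [∀ p, IsMarkovKernel (M p)] {G : ℕ → X → ℝ} {b : ℕ → Bool} {c : ℕ → ℝ}

lemma exists_integral_margSq_le {p : ℕ} (hG : ∀ q < p, BddMeas (G q))
    (hG0 : ∀ q < p, ∀ x, 0 < G q x) (hc : ∀ q ≤ p, 0 < c q) :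
    ∃ C, ∀ N, 1 ≤ N → (∀ q ≤ p, 2 ≤ npart c N q) →
      ∫ ω, margSq (npart c N p) (pairW b G (npart c N) p ω) ∂(pfLaw M0 M G (npart c N) p) ≤ C := by
  induction p with
  | zero =>
    refine ⟨2, fun N _ h2 => ?_⟩
    have : IsProbabilityMeasure (pfLaw M0 M G (npart c N) 0) :=
      isProbabilityMeasure_pfLaw (by simp) (by simp) (by simp)
    simp [pairW_zero, margSq_stepW_one (h2 0 le_rfl)]
  | succ p ih =>
    obtain ⟨C, hC⟩ := ih (fun q hq => hG q (by lia)) (fun q hq => hG0 q (by lia))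
      fun q hq => hc q (by lia)
    obtain ⟨Cg, hCg⟩ := (hG p (by lia)).2
    refine ⟨Cg ^ 4 * (4 + 2 * (2 * (c p + 1) / c (p + 1))) * C, fun N hN h2 => ?_⟩
    have h1 : ∀ q ≤ p, 1 ≤ npart c N q := fun q hq => by linarith [h2 q (by lia)]
    have := isProbabilityMeasure_pfLaw (M0 := M0) (M := M) (k := p) (Np := npart c N)
      (fun q hq => h1 q hq.le) (fun q hq => (hG q (by lia)).1) fun q hq => hG0 q (by lia)
    have hGb : ∀ q < p, ∃ C, ∀ x, |G q x| ≤ C := fun q hq => (hG q (by lia)).2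
    rw [integral_pfLaw_succ h1 (fun q hq => (hG q (by lia)).1) (fun q hq => hG0 q (by lia))
      (bddMeas_margSq_pairW (fun q hq => (hG q hq).1) (fun q hq => (hG q hq).2) _)]
    have hcp := hc p (by lia)
    have hcp1 := hc (p + 1) le_rfl
    refine le_trans (integral_mono_of_nonneg
      (g := fun ω => Cg ^ 4 * (4 + 2 * (2 * (c p + 1) / c (p + 1))) *
        margSq (npart c N p) (pairW b G (npart c N) p ω))
      (ae_of_all _ fun ω => integral_nonneg fun y => margSq_nonneg _ _)
      (((bddMeas_margSq_pairW (fun q hq => (hG q (by lia)).1) hGb _).const_mul _).integrable _)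
      (ae_of_all _ fun ω => ?_)) ?_
    · simp only [pairW_stepMap]
      exact integral_margSq_step_le (h1 p le_rfl) (h2 (p + 1) le_rfl) (hG0 p (by lia))
        (fun x => (le_abs_self _).trans (hCg x))
        (pairW_nonneg h1 (fun q hq => hG0 q (by lia)) ω)
        ((exists_abs_pairW_le hGb).imp fun _ h => h ω) (ω.1 p)
        (npart_ratio_le hN hcp hcp1 (h2 (p + 1) le_rfl))
    · rw [integral_const_mul]
      exact mul_le_mul_of_nonneg_left (hC N hN fun q hq => h2 q (by lia)) (by positivity)

omit [∀ p, IsMarkovKernel (M p)] in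
lemma integral_sq_pairSum_zero_le {Np : ℕ → ℕ} (hm : 2 ≤ Np 0) {ψ : X × X → ℝ} (hψ : BddMeas ψ)
    {C : ℝ} (hC : ∀ q, |ψ q| ≤ C) :
    ∫ ω, (pairSum (Np 0) (pairW b G Np 0 ω) (ω.1 0) ψ - muB M0 M G 0 b ψ) ^ 2
      ∂(pfLaw M0 M G Np 0) ≤ 10 * C ^ 2 / Np 0 := by
  have hm' : (2 : ℝ) ≤ Np 0 := by exact_mod_cast hm
  let e : X → ℕ × X := fun x => (0, x)
  have he : Measurable e := by fun_prop
  have : IsProbabilityMeasure (M0.map e) := Measure.isProbabilityMeasure_map he.aemeasurable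
  have hei : Measurable fun (x : Fin (Np 0) → X) i => e (x i) :=
    measurable_pi_lambda _ fun i => he.comp (measurable_pi_apply i)
  have hpi : (Measure.pi fun _ : Fin (Np 0) => M0).map (fun x i => e (x i)) =
      Measure.pi fun _ : Fin (Np 0) => M0.map e := Measure.pi_map_pi fun _ => he.aemeasurable
  have hS : BddMeas fun ω : (ℕ → ℕ → X) × (ℕ → ℕ → ℕ) =>
      (pairSum (Np 0) (pairW b G Np 0 ω) (ω.1 0) ψ - muB M0 M G 0 b ψ) ^ 2 :=
    ((bddMeas_pairSum_pairW (by simp) (by simp) _ hψ).sub (BddMeas.const _)).sq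
  have hpad : Measurable fun x : Fin (Np 0) → X =>
      ((fun p => if p = 0 then padF x else fun _ => Classical.arbitrary X, fun _ _ => 0) :
        (ℕ → ℕ → X) × (ℕ → ℕ → ℕ)) := by
    refine Measurable.prodMk (measurable_pi_lambda _ fun p => ?_) measurable_const
    split_ifs
    exacts [measurable_padF, measurable_const]
  have key := integral_sq_pairSum_stepW_le (ν := M0.map e) (m := Np 0) (b := b 0)
    (H := fun _ _ => 1) hm (fun _ _ _ => rfl) ⟨1, fun _ _ => abs_one.le⟩
    (fun _ _ => zero_le_one) hψ hC (muB M0 M G 0 b ψ)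
  have hd : ∫ q, 1 * diagIf (b 0) ψ (q.1.2, q.2.2) ∂((M0.map e).prod (M0.map e)) =
      muB M0 M G 0 b ψ := by
    have h := ((diagIf_bddMeas (b 0) hψ).comp
      (g := fun q : (ℕ × X) × (ℕ × X) => (q.1.2, q.2.2)) (by fun_prop)).1
    simp only [one_mul]
    rw [Measure.map_prod_map _ _ he he, integral_map (by fun_prop) h.aestronglyMeasurable,
      muB_zero hψ]
    rfl
  rw [hd, sub_self, ← hpi, integral_map hei.aemeasurable ?_] at key
  · rw [pfLaw, integral_map hpad.aemeasurable hS.1.aestronglyMeasurable]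
    refine key.trans ?_
    simp only [rowSq, integral_const, probReal_univ, one_smul, one_pow]
    have h1 : 2 * 1 / ((Np 0 : ℝ) - 1) ≤ 2 := by
      rw [div_le_iff₀ (by linarith)]
      linarith
    have h2 : 0 ≤ C ^ 2 / Np 0 := by positivity
    calc _ ≤ (0 : ℝ) ^ 2 + C ^ 2 / Np 0 * (4 * (1 + 1) + 2) := by gcongr
      _ = _ := by ring
  · have hz : Measurable fun y : Fin (Np 0) → ℕ × X => padF fun i => (y i).2 :=
      measurable_padF.comp (by fun_prop)
    have hs : BddMeas fun y : Fin (Np 0) → ℕ × X =>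
        (pairSum (Np 0) (stepW (b 0) (Np 0) fun _ _ => 1) (padF fun i => (y i).2) ψ -
          muB M0 M G 0 b ψ) ^ 2 :=
      ((BddMeas.sum _ fun i _ => BddMeas.sum _ fun j _ => (BddMeas.const _).mul
        (hψ.comp (by fun_prop))).sub (BddMeas.const _)).sq
    exact hs.1.aestronglyMeasurable

lemma exists_integral_sq_pairSum_sub_muB_le {p : ℕ} (hG : ∀ q < p, BddMeas (G q))
    (hG0 : ∀ q < p, ∀ x, 0 < G q x) (hc : ∀ q ≤ p, 0 < c q) {ψ : X × X → ℝ} (hψ : BddMeas ψ) :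
    ∃ C, ∀ N, 1 ≤ N → (∀ q ≤ p, 2 ≤ npart c N q) →
      N * ∫ ω, (pairSum (npart c N p) (pairW b G (npart c N) p ω) (ω.1 p) ψ -
        muB M0 M G p b ψ) ^ 2 ∂(pfLaw M0 M G (npart c N) p) ≤ C := by
  induction p generalizing ψ with
  | zero =>
    obtain ⟨C, hC⟩ := hψ.2
    refine ⟨10 * C ^ 2 * (1 / c 0), fun N hN h2 => ?_⟩
    calc _ ≤ N * (10 * C ^ 2 / npart c N 0) := mul_le_mul_of_nonneg_left
          (integral_sq_pairSum_zero_le (h2 0 le_rfl) hψ hC) (Nat.cast_nonneg _)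
      _ = 10 * C ^ 2 * (N / npart c N 0) := by ring
      _ ≤ _ := mul_le_mul_of_nonneg_left (div_npart_le hN (hc 0 le_rfl)) (by positivity)
  | succ p ih =>
    have hψ' := bddMeas_pairOp (M := M) (b := b) (hG p (by lia)) hψ (p + 1)
    obtain ⟨A, hA⟩ := ih (fun q hq => hG q (by lia)) (fun q hq => hG0 q (by lia))
      (fun q hq => hc q (by lia)) hψ'
    obtain ⟨D, hD⟩ := exists_integral_margSq_le (M0 := M0) (M := M) (p := p) (b := b)
      (fun q hq => hG q (by lia))
      (fun q hq => hG0 q (by lia)) fun q hq => hc q (by lia)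
    obtain ⟨C, hC⟩ := hψ.2
    obtain ⟨Cg, hCg⟩ := (hG p (by lia)).2
    have hcp := hc p (by lia)
    have hcp1 := hc (p + 1) le_rfl
    refine ⟨A + C ^ 2 * (Cg ^ 4 * (8 + 2 * (2 * (c p + 1) / c (p + 1)))) *
      (1 / c (p + 1)) * |D|, fun N hN h2 => ?_⟩
    have h1 : ∀ q ≤ p, 1 ≤ npart c N q := fun q hq => by linarith [h2 q (by lia)]
    have := isProbabilityMeasure_pfLaw (M0 := M0) (M := M) (k := p) (Np := npart c N)
      (fun q hq => h1 q hq.le) (fun q hq => (hG q (by lia)).1) fun q hq => hG0 q (by lia)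
    have hGm : ∀ q < p, Measurable (G q) := fun q hq => (hG q (by lia)).1
    have hGb : ∀ q < p, ∃ C, ∀ x, |G q x| ≤ C := fun q hq => (hG q (by lia)).2
    have hS := bddMeas_pairSum_pairW (b := b) (Np := npart c N) hGm hGb (npart c N p) hψ'
    have hMs := bddMeas_margSq_pairW (b := b) (Np := npart c N) hGm hGb (npart c N p)
    rw [integral_pfLaw_succ h1 (fun q hq => (hG q (by lia)).1) (fun q hq => hG0 q (by lia))
      ((bddMeas_pairSum_pairW (fun q hq => (hG q hq).1) (fun q hq => (hG q hq).2) _ hψ).sub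
        (BddMeas.const _)).sq, muB_succ (fun q hq => hG q (by lia)) hψ]
    set E := C ^ 2 * (Cg ^ 4 * (8 + 2 * (2 * (c p + 1) / c (p + 1)))) with hE
    have hE0 : 0 ≤ E := by positivity
    have key := integral_mono_of_nonneg (μ := pfLaw M0 M G (npart c N) p)
      (f := fun ω => ∫ y, (pairSum (npart c N (p + 1)) (pairW b G (npart c N) (p + 1)
        (stepMap p (ω, y))) ((stepMap p (ω, y)).1 (p + 1)) ψ -
          muB M0 M G p b (pairOp (b (p + 1)) (G p) (M (p + 1)) ψ)) ^ 2
        ∂(Measure.pi fun _ : Fin (npart c N (p + 1)) =>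
          moveLaw (npart c N p) (G p) (M (p + 1)) (ω.1 p)))
      (g := fun ω => (pairSum (npart c N p) (pairW b G (npart c N) p ω) (ω.1 p)
        (pairOp (b (p + 1)) (G p) (M (p + 1)) ψ) -
          muB M0 M G p b (pairOp (b (p + 1)) (G p) (M (p + 1)) ψ)) ^ 2 +
        E / npart c N (p + 1) * margSq (npart c N p) (pairW b G (npart c N) p ω))
      (ae_of_all _ fun ω => integral_nonneg fun y => sq_nonneg _)
      (((hS.sub (BddMeas.const _)).sq.add (hMs.const_mul _)).integrable _)
      (ae_of_all _ fun ω => by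
        have hz : ∀ y : Fin (npart c N (p + 1)) → ℕ × X,
            (stepMap p (ω, y)).1 (p + 1) = padF fun i => (y i).2 := fun y => by simp [stepMap]
        simp only [pairW_stepMap, hz]
        exact integral_sq_pairSum_step_le (h1 p le_rfl) (h2 (p + 1) le_rfl) (hG0 p (by lia))
          (fun x => (le_abs_self _).trans (hCg x))
          (pairW_nonneg h1 (fun q hq => hG0 q (by lia)) ω)
          ((exists_abs_pairW_le hGb).imp fun _ h => h ω) (ω.1 p)
          (npart_ratio_le hN hcp hcp1 (h2 (p + 1) le_rfl)) hψ hC _)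
    rw [integral_add ((hS.sub (BddMeas.const _)).sq.integrable _)
      ((hMs.const_mul _).integrable _), integral_const_mul] at key
    refine (mul_le_mul_of_nonneg_left key (Nat.cast_nonneg N)).trans ?_
    rw [mul_add]
    refine add_le_add (hA N hN fun q hq => h2 q (by lia)) ?_
    calc _ = E * (N / npart c N (p + 1)) * ∫ ω, margSq (npart c N p)
          (pairW b G (npart c N) p ω) ∂(pfLaw M0 M G (npart c N) p) := by ring
      _ ≤ E * (1 / c (p + 1)) * |D| := by
        have h3 := div_npart_le (N := N) hN hcp1
        have h4 := (hD N hN fun q hq => h2 q (by lia)).trans (le_abs_self D)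
        have h5 : 0 ≤ ∫ ω, margSq (npart c N p)
          (pairW b G (npart c N) p ω) ∂(pfLaw M0 M G (npart c N) p) :=
          integral_nonneg fun ω => margSq_nonneg _ _
        gcongr

end Convergence

section Tracing

/-- Indicator of the constraint imposed by `I(b)` on the indices of a single generation. -/
def matchInd (b : Bool) (N k l : ℕ) : ℝ := if k < N ∧ l < N ∧ (k = l ↔ b = true) then 1 else 0

/-- The factor attached to one generation in the definition of `μ_b^N`. -/
def normW (b : Bool) (N : ℕ) : ℝ := if b then (N : ℝ) else (N : ℝ) / ((N : ℝ) - 1)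

lemma stepW_eq (b : Bool) {N : ℕ} (hN : 2 ≤ N) (h : ℕ → ℕ → ℝ) (i j : ℕ) :
    stepW b N h i j = matchInd b N i j * (normW b N * ((N : ℝ) ^ 2)⁻¹ * h i j) := by
  have hN' : (2 : ℝ) ≤ N := by exact_mod_cast hN
  have hN1 : (N : ℝ) - 1 ≠ 0 := by linarith
  have hN0 : (N : ℝ) ≠ 0 := by linarith
  rw [stepW, matchInd]
  split_ifs <;> simp_all [normW] <;> field_simp <;> exact Or.inl trivial

lemma trace_self (A : ℕ → ℕ → ℕ) (n k : ℕ) : trace A n k n = k := by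
  simp [trace, traceAux]

lemma trace_of_lt (A : ℕ → ℕ → ℕ) {n p : ℕ} (h : p < n) (k : ℕ) :
    trace A n k p = A p (trace A n k (p + 1)) := by
  obtain ⟨j, rfl⟩ := Nat.exists_eq_add_of_lt h
  have h1 : p + j + 1 - p = j + 1 := by lia
  have h2 : p + j + 1 - (p + 1) = j := by lia
  have h3 : p + j + 1 - (j + 1) = p := by lia
  simp [trace, h1, h2, traceAux, h3]

variable {G : ℕ → X → ℝ} {Np : ℕ → ℕ} {b : ℕ → Bool} {ω : (ℕ → ℕ → X) × (ℕ → ℕ → ℕ)}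
  {K1 : ℕ → ℕ}

omit [MeasurableSpace X] in
lemma isProbabilityMeasure_resample {p : ℕ} (hN : 1 ≤ Np p) (hG : ∀ x, 0 < G p x) (v : ℕ) :
    IsProbabilityMeasure (if v = K1 (p + 1) then cat (Np p) fun j => G p (ω.1 p j)
      else Measure.dirac (ω.2 p v)) := by
  split_ifs
  · exact isProbabilityMeasure_cat (fun j => (hG _).le) (sum_weight_pos hN hG _)
  · infer_instance

omit [MeasurableSpace X] in
lemma isProbabilityMeasure_k2Law {p : ℕ} (hN : ∀ q < p, 1 ≤ Np q)
    (hG : ∀ q < p, ∀ x, 0 < G q x) (v : ℕ) : IsProbabilityMeasure (k2Law G Np ω K1 p v) := by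
  induction p generalizing v with
  | zero =>
    rw [k2Law]
    infer_instance
  | succ p ih =>
    have := ih (fun q hq => hN q (by lia)) fun q hq => hG q (by lia)
    have := isProbabilityMeasure_resample (ω := ω) (K1 := K1) (hN p (by lia)) (hG p (by lia)) v
    have : ∀ w, IsProbabilityMeasure ((k2Law G Np ω K1 p w).map
        fun f => Function.update f (p + 1) v) := fun w =>
      Measure.isProbabilityMeasure_map measurable_update_left.aemeasurable
    exact isProbabilityMeasure_bind_of_forall measurable_from_top

omit [MeasurableSpace X] in
lemma integral_k2Law_succ {p : ℕ} (hN : ∀ q ≤ p, 1 ≤ Np q)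
    (hG : ∀ q ≤ p, ∀ x, 0 < G q x) (v : ℕ) {F : (ℕ → ℕ) → ℝ} (hF : BddMeas F) :
    ∫ f, F f ∂(k2Law G Np ω K1 (p + 1) v) =
      ∫ w, ∫ f, F (Function.update f (p + 1) v) ∂(k2Law G Np ω K1 p w)
        ∂(if v = K1 (p + 1) then cat (Np p) fun j => G p (ω.1 p j)
          else Measure.dirac (ω.2 p v)) := by
  have := isProbabilityMeasure_k2Law (ω := ω) (K1 := K1) (fun q hq => hN q (le_of_lt hq))
    fun q hq => hG q (le_of_lt hq)
  have := isProbabilityMeasure_resample (ω := ω) (K1 := K1) (hN p le_rfl) (hG p le_rfl) v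
  have : ∀ w, IsProbabilityMeasure ((k2Law G Np ω K1 p w).map
      fun f => Function.update f (p + 1) v) := fun w =>
    Measure.isProbabilityMeasure_map measurable_update_left.aemeasurable
  rw [k2Law, integral_bind_of_bddMeas measurable_from_top hF]
  exact integral_congr_ae (ae_of_all _ fun w =>
    integral_map measurable_update_left.aemeasurable hF.1.aestronglyMeasurable)

omit [MeasurableSpace X] in
lemma integral_k2Law_update {p : ℕ} (hN : ∀ q < p, 1 ≤ Np q)
    (hG : ∀ q < p, ∀ x, 0 < G q x) (v : ℕ) {F : (ℕ → ℕ) → ℝ} (hF : BddMeas F) :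
    ∫ f, F f ∂(k2Law G Np ω K1 p v) =
      ∫ f, F (Function.update f p v) ∂(k2Law G Np ω K1 p v) := by
  have hF' : BddMeas fun f => F (Function.update f p v) := hF.comp measurable_update_left
  cases p with
  | zero =>
    rw [k2Law, integral_dirac' _ _ hF.1.stronglyMeasurable,
      integral_dirac' _ _ hF'.1.stronglyMeasurable]
    congr 1
    ext q
    by_cases hq : q = 0 <;> simp [hq]
  | succ p =>
    rw [integral_k2Law_succ (fun q hq => hN q (by lia)) (fun q hq => hG q (by lia)) v hF,
      integral_k2Law_succ (fun q hq => hN q (by lia)) (fun q hq => hG q (by lia)) v hF']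
    simp only [Function.update_idem]

/-- Indicator of the constraint imposed by `I(b)` on the generations up to `p`. -/
def pathInd (b : ℕ → Bool) (Np : ℕ → ℕ) (p : ℕ) (K1 f : ℕ → ℕ) : ℝ :=
  ∏ q ∈ Finset.range (p + 1), matchInd (b q) (Np q) (K1 q) (f q)

lemma bddMeas_matchInd {α : Type*} [MeasurableSpace α] (b : Bool) (N : ℕ) {u v : α → ℕ}
    (hu : Measurable u) (hv : Measurable v) : BddMeas fun x => matchInd b N (u x) (v x) := by
  have h : BddMeas fun r : ℕ × ℕ => matchInd b N r.1 r.2 := by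
    refine ⟨measurable_of_countable _, 1, fun r => ?_⟩
    simp only [matchInd]
    split_ifs <;> simp
  exact h.comp (hu.prodMk hv)

lemma bddMeas_pathInd (p : ℕ) :
    BddMeas fun k : (ℕ → ℕ) × (ℕ → ℕ) => pathInd b Np p k.1 k.2 :=
  BddMeas.prod _ fun _ _ => bddMeas_matchInd _ _ (by fun_prop) (by fun_prop)

lemma pathInd_eq (n : ℕ) (k : (ℕ → ℕ) × (ℕ → ℕ)) :
    pathInd b Np n k.1 k.2 = if inI Np n b k then 1 else 0 := by
  simp only [pathInd, matchInd, inI, Finset.prod_ite_zero, Finset.prod_const_one, Finset.mem_range,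
    Nat.lt_succ_iff]
  congr

omit [MeasurableSpace X] in
lemma integral_pathInd_succ {p : ℕ} (hN : ∀ q ≤ p, 1 ≤ Np q)
    (hG : ∀ q ≤ p, ∀ x, 0 < G q x) (v : ℕ) :
    ∫ f, pathInd b Np (p + 1) K1 f ∂(k2Law G Np ω K1 (p + 1) v) =
      matchInd (b (p + 1)) (Np (p + 1)) (K1 (p + 1)) v *
        ∫ w, ∫ f, pathInd b Np p K1 f ∂(k2Law G Np ω K1 p w)
          ∂(if v = K1 (p + 1) then cat (Np p) fun j => G p (ω.1 p j)
            else Measure.dirac (ω.2 p v)) := by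
  rw [integral_k2Law_succ hN hG v ((bddMeas_pathInd (p + 1)).comp (g := fun f => (K1, f))
    (by fun_prop))]
  have h : ∀ f, pathInd b Np (p + 1) K1 (Function.update f (p + 1) v) =
      matchInd (b (p + 1)) (Np (p + 1)) (K1 (p + 1)) v * pathInd b Np p K1 f := fun f => by
    rw [pathInd, Finset.prod_range_succ, Function.update_self, mul_comm, pathInd]
    congr 1
    exact Finset.prod_congr rfl fun q hq => by
      rw [Function.update_of_ne (Finset.mem_range.1 hq).ne]
  simp only [h, integral_const_mul]

omit [MeasurableSpace X] in
lemma pairW_eq_integral {p : ℕ} (hN : ∀ q ≤ p, 2 ≤ Np q) (hG : ∀ q < p, ∀ x, 0 < G q x)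
    (hK : ∀ q < p, K1 q = ω.2 q (K1 (q + 1))) (v : ℕ) :
    pairW b G Np p ω (K1 p) v =
      (∏ q ∈ Finset.range (p + 1), normW (b q) (Np q)) *
        (∏ q ∈ Finset.range p, etaN Np q (G q) ω) ^ 2 * ((Np p : ℝ) ^ 2)⁻¹ *
          ∫ f, pathInd b Np p K1 f ∂(k2Law G Np ω K1 p v) := by
  induction p generalizing v with
  | zero =>
    have h := ((bddMeas_pathInd (b := b) (Np := Np) 0).comp (g := fun f => (K1, f))
      (by fun_prop)).1
    rw [pairW_zero, stepW_eq _ (hN 0 le_rfl), k2Law, integral_dirac' _ _ h.stronglyMeasurable]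
    simp [pathInd]
    ring
  | succ p ih =>
    have hih := ih (fun q hq => hN q (by lia)) (fun q hq => hG q (by lia))
      fun q hq => hK q (by lia)
    have hN1 : ∀ q ≤ p, 1 ≤ Np q := fun q hq => by linarith [hN q (by lia)]
    have hNp : (Np p : ℝ) ≠ 0 := by
      have := hN1 p le_rfl
      positivity
    have hS := sum_weight_pos (hN1 p le_rfl) (hG p (by lia)) (ω.1 p)
    have hη : etaN Np p (G p) ω = (Np p : ℝ)⁻¹ * ∑ j ∈ Finset.range (Np p), G p (ω.1 p j) := rfl
    rw [pairW_succ, stepW_eq _ (hN _ le_rfl), integral_pathInd_succ hN1 fun q hq => hG q (by lia),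
      ← hK p (by lia), Finset.prod_range_succ,
      Finset.prod_range_succ (fun q => etaN Np q (G q) ω), hη]
    set J := fun w => ∫ f, pathInd b Np p K1 f ∂(k2Law G Np ω K1 p w)
    set P := ∏ q ∈ Finset.range (p + 1), normW (b q) (Np q)
    set Q := ∏ q ∈ Finset.range p, etaN Np q (G q) ω
    set S := ∑ j ∈ Finset.range (Np p), G p (ω.1 p j) with hSdef
    have key : matchInd (b (p + 1)) (Np (p + 1)) (K1 (p + 1)) v ≠ 0 →
        parentW (b (p + 1)) (Np p) (fun k => G p (ω.1 p k)) (pairW b G Np p ω) (K1 p)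
          (ω.2 p v) = S ^ 2 * (P * Q ^ 2 * ((Np p : ℝ) ^ 2)⁻¹ *
            ∫ w, J w ∂(if v = K1 (p + 1) then cat (Np p) fun j => G p (ω.1 p j)
              else Measure.dirac (ω.2 p v))) := fun h0 => by
      have hcond : K1 (p + 1) = v ↔ b (p + 1) = true := by
        by_contra hcon
        exact h0 (if_neg fun h => hcon h.2.2)
      cases hb : b (p + 1)
      · have hne : v ≠ K1 (p + 1) := fun h => by simp [hb, h] at hcond
        simp only [if_neg hne, integral_dirac, parentW, Bool.false_eq_true, if_false, hih, ← hSdef]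
        rfl
      · have he : v = K1 (p + 1) := (hcond.2 hb).symm
        simp only [if_pos he, parentW, if_true, hih, ← hSdef]
        rw [integral_cat fun j => (hG p (by lia) _).le, Finset.mul_sum, Finset.mul_sum,
          Finset.mul_sum]
        refine Finset.sum_congr rfl fun l _ => ?_
        rw [← hSdef]
        change S * (P * Q ^ 2 * ((Np p : ℝ) ^ 2)⁻¹ * J l * _) = _
        field_simp
    by_cases h0 : matchInd (b (p + 1)) (Np (p + 1)) (K1 (p + 1)) v = 0
    · simp [h0]
    · rw [key h0]
      field_simp

omit [MeasurableSpace X] in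
lemma gammaN_one {n : ℕ} (hN : 1 ≤ Np n) :
    gammaN G Np n 1 ω = ∏ p ∈ Finset.range n, etaN Np p (G p) ω := by
  have h : (Np n : ℝ) ≠ 0 := by positivity
  simp [gammaN, etaN, h]

omit [MeasurableSpace X] in
lemma muBN_eq_pairSum {n : ℕ} (hN : ∀ q ≤ n, 2 ≤ Np q) (hG : ∀ q < n, ∀ x, 0 < G q x)
    {φ : X × X → ℝ} (hφ : ∃ C, ∀ q, |φ q| ≤ C) :
    muBN G Np n b φ ω = pairSum (Np n) (pairW b G Np n ω) (ω.1 n) φ := by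
  have hN1 : ∀ q ≤ n, 1 ≤ Np q := fun q hq => by linarith [hN q hq]
  have hφk : BddMeas fun k : ℕ × ℕ => φ (ω.1 n k.1, ω.1 n k.2) :=
    ⟨measurable_of_countable _, hφ.imp fun _ h k => h _⟩
  have hF : BddMeas fun k : (ℕ → ℕ) × (ℕ → ℕ) =>
      pathInd b Np n k.1 k.2 * φ (ω.1 n (k.1 n), ω.1 n (k.2 n)) :=
    (bddMeas_pathInd n).mul (hφk.comp (g := fun k : (ℕ → ℕ) × (ℕ → ℕ) => (k.1 n, k.2 n))
      (by fun_prop))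
  have hk2 := fun K1 => isProbabilityMeasure_k2Law (ω := ω) (K1 := K1) (Np := Np) (G := G) (p := n)
    (fun q hq => hN1 q hq.le) hG
  have hu : IsProbabilityMeasure (unif (Np n)) :=
    isProbabilityMeasure_cat (fun _ => zero_le_one)
      (by simpa [Nat.pos_iff_ne_zero, Nat.one_le_iff_ne_zero] using hN1 n le_rfl)
  have hmap : ∀ k1 k2, IsProbabilityMeasure ((k2Law G Np ω (trace ω.2 n k1) n k2).map
      fun k => (trace ω.2 n k1, k)) := fun k1 k2 =>
    have := hk2 (trace ω.2 n k1) k2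
    Measure.isProbabilityMeasure_map (by fun_prop)
  have hbind : ∀ k1, IsProbabilityMeasure ((unif (Np n)).bind fun k2 =>
      (k2Law G Np ω (trace ω.2 n k1) n k2).map fun k => (trace ω.2 n k1, k)) := fun k1 =>
    isProbabilityMeasure_bind_of_forall measurable_from_top
  have hin : ∀ k1 k2, ∫ k, pathInd b Np n k.1 k.2 * φ (ω.1 n (k.1 n), ω.1 n (k.2 n))
      ∂((k2Law G Np ω (trace ω.2 n k1) n k2).map fun k => (trace ω.2 n k1, k)) =
      (∫ f, pathInd b Np n (trace ω.2 n k1) f ∂(k2Law G Np ω (trace ω.2 n k1) n k2)) *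
        φ (ω.1 n k1, ω.1 n k2) := fun k1 k2 => by
    have h1 := (bddMeas_pathInd (b := b) (Np := Np) n).comp (g := fun f => (trace ω.2 n k1, f))
      (by fun_prop)
    rw [integral_map (by fun_prop) hF.1.aestronglyMeasurable,
      integral_k2Law_update (fun q hq => hN1 q hq.le) hG k2
        (hF.comp (g := fun f => (trace ω.2 n k1, f)) (by fun_prop)),
      integral_k2Law_update (fun q hq => hN1 q hq.le) hG k2 h1]
    simp only [Function.update_self, trace_self, integral_mul_const]
  have hint : ∫ k, (if inI Np n b k then (1 : ℝ) else 0) * φ (ω.1 n (k.1 n), ω.1 n (k.2 n))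
      ∂(kLaw G Np n ω) = ∑ i ∈ Finset.range (Np n), ∑ j ∈ Finset.range (Np n),
        ((Np n : ℝ) ^ 2)⁻¹ * ((∫ f, pathInd b Np n (trace ω.2 n i) f
          ∂(k2Law G Np ω (trace ω.2 n i) n j)) * φ (ω.1 n i, ω.1 n j)) := by
    simp only [← pathInd_eq]
    rw [kLaw, integral_bind_of_bddMeas measurable_from_top hF]
    simp only [integral_bind_of_bddMeas measurable_from_top hF, hin]
    simp only [unif, integral_cat fun _ => zero_le_one' ℝ, Finset.mul_sum, Finset.sum_const,
      Finset.card_range, nsmul_eq_mul, mul_one]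
    refine Finset.sum_congr rfl fun i _ => Finset.sum_congr rfl fun j _ => ?_
    ring
  rw [muBN, hint, gammaN_one (hN1 n le_rfl), pairSum, Finset.mul_sum]
  refine Finset.sum_congr rfl fun i _ => ?_
  rw [Finset.mul_sum]
  refine Finset.sum_congr rfl fun j _ => ?_
  have h := pairW_eq_integral (b := b) (K1 := trace ω.2 n i) hN hG
    (fun q hq => trace_of_lt ω.2 hq i) j
  rw [trace_self] at h
  rw [h]
  simp only [normW]
  ring

end Tracing

omit [MeasurableSpace X] in
lemma eventually_two_le_npart {c : ℕ → ℝ} {n : ℕ} (hc : ∀ p ≤ n, 0 < c p) :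
    ∀ᶠ N : ℕ in atTop, ∀ p ≤ n, 2 ≤ npart c N p := by
  have h : ∀ p ∈ Finset.range (n + 1), ∀ᶠ N : ℕ in atTop, 2 ≤ npart c N p := fun p hp => by
    have ht : Tendsto (fun N : ℕ => c p * (N : ℝ)) atTop atTop :=
      tendsto_natCast_atTop_atTop.const_mul_atTop (hc p (by simpa [Nat.lt_succ_iff] using hp))
    filter_upwards [ht.eventually_ge_atTop 2] with N hN
    exact_mod_cast hN.trans (Nat.le_ceil _)
  filter_upwards [(Filter.eventually_all_finset _).2 h] with N hN p hp
  exact hN p (by simpa [Nat.lt_succ_iff] using hp)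

open PFVar MeasureTheory ProbabilityTheory Filter

theorem statement13
    {X : Type*} [MeasurableSpace X] [Nonempty X] (hX : ∃ x y : X, x ≠ y) (n : ℕ)
    (M0 : Measure X) [IsProbabilityMeasure M0]
    (M : ℕ → Kernel X X) [∀ p, IsMarkovKernel (M p)]
    (G : ℕ → X → ℝ) (hGm : ∀ p ≤ n, Measurable (G p))
    (hGpos : ∀ p ≤ n, ∀ x, 0 < G p x) (hGbd : ∀ p ≤ n, ∃ C, ∀ x, G p x ≤ C)
    (c : ℕ → ℝ) (hc : ∀ p ≤ n, 0 < c p)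
    (b : Fin (n + 1) → Bool)
    (φ : X × X → ℝ) (hφm : Measurable φ) (hφb : ∃ C, ∀ q, |φ q| ≤ C) :
    (∃ C : ℝ, ∀ N : ℕ, 1 ≤ N → (∀ p ≤ n, 2 ≤ npart c N p) →
      (N : ℝ) * ∫ ω, (muBN G (npart c N) n (extB n b) φ ω - muB M0 M G n (extB n b) φ) ^ 2
          ∂(pfLaw M0 M G (npart c N) n) ≤ C) ∧
    (∀ ε : ℝ, 0 < ε →
      Tendsto (fun N : ℕ =>
          pfLaw M0 M G (npart c N) n
            {ω | ε ≤ |muBN G (npart c N) n (extB n b) φ ω - muB M0 M G n (extB n b) φ|})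
        atTop (nhds 0)) := by
  have hG0 : ∀ q < n, ∀ x, 0 < G q x := fun q hq => hGpos q hq.le
  have hGb : ∀ q < n, ∃ C, ∀ x, |G q x| ≤ C := fun q hq =>
    (hGbd q hq.le).imp fun C h x => (abs_of_pos (hG0 q hq x)).trans_le (h x)
  have hφ : BddMeas φ := ⟨hφm, hφb⟩
  obtain ⟨C, hC⟩ := exists_integral_sq_pairSum_sub_muB_le (M0 := M0) (M := M) (b := extB n b)
    (fun q hq => ⟨hGm q hq.le, hGb q hq⟩) hG0 hc hφ
  refine ⟨⟨C, fun N hN h2 => ?_⟩, fun ε hε => ?_⟩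
  · simp only [muBN_eq_pairSum h2 hG0 hφb]
    exact hC N hN h2
  have hlim : Tendsto (fun N : ℕ => ENNReal.ofReal (C / ε ^ 2 / N)) atTop (nhds 0) := by
    simpa using ENNReal.tendsto_ofReal (tendsto_const_div_atTop_nhds_zero_nat (C / ε ^ 2))
  refine tendsto_of_tendsto_of_tendsto_of_le_of_le' tendsto_const_nhds hlim
    (.of_forall fun _ => zero_le) ?_
  filter_upwards [eventually_two_le_npart hc, eventually_ge_atTop 1] with N h2 hN
  have hN0 : (0 : ℝ) < N := by exact_mod_cast hN
  have : IsProbabilityMeasure (pfLaw M0 M G (npart c N) n) :=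
    isProbabilityMeasure_pfLaw (fun p hp => by linarith [h2 p hp.le])
      (fun p hp => hGm p hp.le) hG0
  have hf := ((bddMeas_pairSum_pairW (b := extB n b) (Np := npart c N)
    (fun q hq => hGm q hq.le) hGb (npart c N n) hφ).sub
      (.const (muB M0 M G n (extB n b) φ))).sq
  have hcheb := mul_meas_ge_le_integral_of_nonneg (ae_of_all _ fun _ => sq_nonneg _)
    (hf.integrable (pfLaw M0 M G (npart c N) n)) (ε ^ 2)
  have hbd := hC N hN h2
  simp only [muBN_eq_pairSum h2 hG0 hφb]
  rw [← ofReal_measureReal]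
  refine ENNReal.ofReal_le_ofReal ?_
  have hset : {ω | ε ≤ |pairSum (npart c N n) (pairW (extB n b) G (npart c N) n ω) (ω.1 n) φ -
      muB M0 M G n (extB n b) φ|} =
      {ω | ε ^ 2 ≤ (pairSum (npart c N n) (pairW (extB n b) G (npart c N) n ω) (ω.1 n) φ -
        muB M0 M G n (extB n b) φ) ^ 2} := by
    ext ω
    simp only [Set.mem_ofPred_eq, sq_le_sq, abs_of_pos hε]
  rw [hset, div_div, le_div_iff₀ (by positivity)]
  calc _ = N * (ε ^ 2 * _) := by ring
    _ ≤ N * _ := mul_le_mul_of_nonneg_left hcheb hN0.le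
    _ ≤ C := hbd
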